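/- Let L(λ) := M_{τ_1}(Y_1) M_{σ_1}(X_1) (λ M_τ^P − M_σ^P) M_{σ_2}(X_2) M_{τ_2}(Y_2) be an EGFP of P(λ), and suppose P(λ) is singular. Write τ = (τ_l, −m, τ_r) and set α := (−rev(τ_l), σ, −rev(τ_r)), a permutation of {0,…,m−1}; let c_L := c(α) and i_L := i(α) be the total numbers of consecutions and inversions of α. Then: (a) if Z(λ) is a right (resp. left) minimal basis of L(λ), then (e^T_{m−c_0(σ,σ_2)} ⊗ I_n) Z(λ) (resp. (e^T_{m−i_0(σ_1,σ)} ⊗ I_n) Z(λ)) is a right (resp. left) minimal basis of P(λ); and (b) if ε_1 ≤ ⋯ ≤ ε_p are the right (resp. left) minimal indices of L(λ), then ε_1 − i_L ≤ ⋯ ≤ ε_p − i_L (resp. ε_1 − c_L ≤ ⋯ ≤ ε_p − c_L) are the right (resp. left) minimal indices of P(λ). -/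

import Mathlib

open Matrix Polynomial

/-- Signed indices: `pos k` denotes `k` and `neg k` denotes `−k`, with `−0` and `0` distinct. -/
inductive SIdx : Type where
  | pos : ℕ → SIdx
  | neg : ℕ → SIdx
deriving DecidableEq

namespace SIdx

/-- The absolute value of a signed index. -/
def val : SIdx → ℕ
  | pos k => k
  | neg k => k

/-- Whether a signed index is negative. -/
def isNeg : SIdx → Bool
  | pos _ => false
  | neg _ => true

/-- The successor `t + 1` of a signed index (`−s + 1 = −(s−1)`). -/
def succ : SIdx → SIdx
  | pos k => pos (k + 1)
  | neg 0 => pos 0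
  | neg (k + 1) => neg k

/-- Negation of a signed index. -/
def negate : SIdx → SIdx
  | pos k => neg k
  | neg k => pos k

end SIdx

/-- The ascending chain `(t, t+1, …, t+p)`. -/
def chainUp (t : SIdx) : ℕ → List SIdx
  | 0 => [t]
  | p + 1 => t :: chainUp t.succ p

/-- The number of consecutions `c_t(α)` of the index tuple `α` at `t` (`−1` when `t ∉ α`):
the largest `p` such that `(t, t+1, …, t+p)` is a subtuple (sublist) of `α`. -/
noncomputable def consAt (α : List SIdx) (t : SIdx) : ℤ :=
  letI := Classical.decPred (fun p : ℕ => (chainUp t p).Sublist α)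
  if t ∈ α then (Nat.findGreatest (fun p : ℕ => (chainUp t p).Sublist α) α.length : ℤ) else -1

/-- The number of inversions `i_t(α)` of the index tuple `α` at `t` (`−1` when `t ∉ α`):
the largest `q` such that `(t+q, …, t+1, t)` is a subtuple (sublist) of `α`. -/
noncomputable def invsAt (α : List SIdx) (t : SIdx) : ℤ :=
  letI := Classical.decPred (fun p : ℕ => ((chainUp t p).reverse).Sublist α)
  if t ∈ α then (Nat.findGreatest (fun p : ℕ => ((chainUp t p).reverse).Sublist α) α.length : ℤ)
  else -1

/-- The Successor Infix Property: between any two equal entries there is an occurrence of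
their successor. -/
def SIP (α : List SIdx) : Prop :=
  ∀ a b : Fin α.length, a < b → α.get a = α.get b →
    ∃ c : Fin α.length, a < c ∧ c < b ∧ α.get c = (α.get a).succ

/-- The `mn × mn` elementary matrix `M_k(X)` (viewed as an `m × m` block matrix with
`n × n` blocks): `M_0(X) = M_{−0}(X) = diag(I_{(m−1)n}, X)`,
`M_m(X) = M_{−m}(X) = diag(X, I_{(m−1)n})`, and for `1 ≤ i ≤ m−1` the matrix `M_i(X)`
(resp. `M_{−i}(X)`) is the identity except for the 2×2 block submatrix
`[[X, I],[I, 0]]` (resp. `[[0, I],[I, X]]`) in block rows/columns `(m−i, m−i+1)`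
(1-indexed). -/
noncomputable def elemMat (m n : ℕ) (k : SIdx) (X : Matrix (Fin n) (Fin n) ℂ) :
    Matrix (Fin m × Fin n) (Fin m × Fin n) ℂ := fun p q =>
  if k.val = 0 then
    if p.1 = q.1 then (if (p.1 : ℕ) = m - 1 then X p.2 q.2 else if p.2 = q.2 then 1 else 0)
    else 0
  else if k.val = m then
    if p.1 = q.1 then (if (p.1 : ℕ) = 0 then X p.2 q.2 else if p.2 = q.2 then 1 else 0)
    else 0
  else
    if (p.1 : ℕ) = m - k.val - 1 ∧ (q.1 : ℕ) = m - k.val - 1 then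
      (if k.isNeg then 0 else X p.2 q.2)
    else if ((p.1 : ℕ) = m - k.val - 1 ∧ (q.1 : ℕ) = m - k.val) ∨
        ((p.1 : ℕ) = m - k.val ∧ (q.1 : ℕ) = m - k.val - 1) then
      (if p.2 = q.2 then 1 else 0)
    else if (p.1 : ℕ) = m - k.val ∧ (q.1 : ℕ) = m - k.val then
      (if k.isNeg then X p.2 q.2 else 0)
    else if p = q then 1 else 0

/-- `M_t(X) = M_{t_1}(X_1) ⋯ M_{t_r}(X_r)` for an index tuple `t` with matrix assignment `Xs`. -/
noncomputable def prodAssign (m n : ℕ) (t : List SIdx) (Xs : List (Matrix (Fin n) (Fin n) ℂ)) :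
    Matrix (Fin m × Fin n) (Fin m × Fin n) ℂ :=
  ((t.zip Xs).map fun p => elemMat m n p.1 p.2).prod

/-- The trivial (Fiedler) matrix assignment of `P(λ) = Σ λ^i A_i`:
`M_i^P = M_i(−A_i)` for `0 ≤ i ≤ m−1`, `M_m^P = (M_{−m}^P)⁻¹ = M_m(A_m⁻¹)`,
`M_{−i}^P = M_{−i}(A_i)` for `1 ≤ i ≤ m`, and `M_{−0}^P = (M_0^P)⁻¹ = M_{−0}((−A_0)⁻¹)`. -/
noncomputable def fiedlerX (m : ℕ) {n : ℕ} (A : ℕ → Matrix (Fin n) (Fin n) ℂ) :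
    SIdx → Matrix (Fin n) (Fin n) ℂ
  | .pos i => if i = m then (A m)⁻¹ else -A i
  | .neg i => if i = 0 then (-A 0)⁻¹ else A i

/-- `M_t^P`, the product of Fiedler matrices of `P` along the index tuple `t`. -/
noncomputable def prodFiedler (m n : ℕ) (A : ℕ → Matrix (Fin n) (Fin n) ℂ) (t : List SIdx) :
    Matrix (Fin m × Fin n) (Fin m × Fin n) ℂ :=
  (t.map fun k => elemMat m n k (fiedlerX m A k)).prod

/-- A nonsingular matrix assignment: the matrices assigned to positions with indices
`±0` or `±m` are nonsingular. -/
def NonsingAssign (m : ℕ) {n : ℕ} (t : List SIdx) (Xs : List (Matrix (Fin n) (Fin n) ℂ)) :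
    Prop :=
  t.length = Xs.length ∧ ∀ p ∈ t.zip Xs, (p.1.val = 0 ∨ p.1.val = m) → IsUnit p.2

/-- The data of an extended generalized Fiedler pencil (EGFP)
`L(λ) = M_{τ₁}(Y₁) M_{σ₁}(X₁) (λ M_τ^P − M_σ^P) M_{σ₂}(X₂) M_{τ₂}(Y₂)`
of the `n × n` matrix polynomial `P(λ) = Σ_{i=0}^m λ^i A_i` of degree `m ≥ 2`. -/
structure EGFPData (m n : ℕ) where
  /-- coefficients of `P` -/
  A : ℕ → Matrix (Fin n) (Fin n) ℂ
  sig : List SIdx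
  tau : List SIdx
  sig1 : List SIdx
  sig2 : List SIdx
  tau1 : List SIdx
  tau2 : List SIdx
  X1 : List (Matrix (Fin n) (Fin n) ℂ)
  X2 : List (Matrix (Fin n) (Fin n) ℂ)
  Y1 : List (Matrix (Fin n) (Fin n) ℂ)
  Y2 : List (Matrix (Fin n) (Fin n) ℂ)
  hm : 2 ≤ m
  hAm : A m ≠ 0
  hsigpos : ∀ k ∈ sig, k.isNeg = false
  htauneg : ∀ k ∈ tau, k.isNeg = true
  /-- `(σ, ω)` is a permutation of `{0, 1, …, m}`, where `τ = −ω`. -/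
  hperm : List.Perm (sig.map SIdx.val ++ tau.map SIdx.val) (List.range (m + 1))
  hsig1 : ∀ k ∈ sig1, k ∈ sig ∧ k.val + 2 ≤ m
  hsig2 : ∀ k ∈ sig2, k ∈ sig ∧ k.val + 2 ≤ m
  htau1 : ∀ k ∈ tau1, k ∈ tau ∧ 2 ≤ k.val
  htau2 : ∀ k ∈ tau2, k ∈ tau ∧ 2 ≤ k.val
  hSIPsig : SIP (sig1 ++ sig ++ sig2)
  hSIPtau : SIP (tau1 ++ tau ++ tau2)
  hX1 : NonsingAssign m sig1 X1
  hX2 : NonsingAssign m sig2 X2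
  hY1 : NonsingAssign m tau1 Y1
  hY2 : NonsingAssign m tau2 Y2
  hA0 : SIdx.neg 0 ∈ tau → IsUnit (A 0)
  hAmUnit : SIdx.pos m ∈ sig → IsUnit (A m)

namespace EGFPData

variable {m n : ℕ}

/-- `M_{τ₁}(Y₁) M_{σ₁}(X₁)`. -/
noncomputable def leftFac (E : EGFPData m n) : Matrix (Fin m × Fin n) (Fin m × Fin n) ℂ :=
  prodAssign m n E.tau1 E.Y1 * prodAssign m n E.sig1 E.X1

/-- `M_{σ₂}(X₂) M_{τ₂}(Y₂)`. -/
noncomputable def rightFac (E : EGFPData m n) : Matrix (Fin m × Fin n) (Fin m × Fin n) ℂ :=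
  prodAssign m n E.sig2 E.X2 * prodAssign m n E.tau2 E.Y2

/-- The coefficient `L₁` of `λ` in `L(λ) = λ L₁ − L₀`. -/
noncomputable def L1 (E : EGFPData m n) : Matrix (Fin m × Fin n) (Fin m × Fin n) ℂ :=
  E.leftFac * prodFiedler m n E.A E.tau * E.rightFac

/-- The constant term `L₀` in `L(λ) = λ L₁ − L₀`. -/
noncomputable def L0 (E : EGFPData m n) : Matrix (Fin m × Fin n) (Fin m × Fin n) ℂ :=
  E.leftFac * prodFiedler m n E.A E.sig * E.rightFac

end EGFPData

/-- The `(i, j)` block (of size `n × n`) of an `mn × mn` matrix. -/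
def blockOf {m n : ℕ} (M : Matrix (Fin m × Fin n) (Fin m × Fin n) ℂ) (i j : Fin m) :
    Matrix (Fin n) (Fin n) ℂ := fun p q => M (i, p) (j, q)

/-- Block penta-diagonal: all blocks `B_{ij}` with `|i − j| > 2` vanish. -/
def BlockPenta {m n : ℕ} (M : Matrix (Fin m × Fin n) (Fin m × Fin n) ℂ) : Prop :=
  ∀ i j : Fin m, ((i : ℕ) + 2 < (j : ℕ) ∨ (j : ℕ) + 2 < (i : ℕ)) → blockOf M i j = 0

/-- Block tridiagonal: all blocks `B_{ij}` with `|i − j| > 1` vanish. -/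
def BlockTri {m n : ℕ} (M : Matrix (Fin m × Fin n) (Fin m × Fin n) ℂ) : Prop :=
  ∀ i j : Fin m, ((i : ℕ) + 1 < (j : ℕ) ∨ (j : ℕ) + 1 < (i : ℕ)) → blockOf M i j = 0

/-- `e_j^T ⊗ I_n` as an `n × mn` matrix, for a 1-indexed block index `j`
(zero when `j` is out of range). -/
def rowSel (m n : ℕ) (j : ℤ) : Matrix (Fin n) (Fin m × Fin n) ℂ :=
  fun p q => if ((q.1 : ℕ) : ℤ) + 1 = j ∧ p = q.2 then 1 else 0

/-- `e_j ⊗ I_n` as an `mn × n` matrix, for a 1-indexed block index `j`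
(zero when `j` is out of range). -/
def colSel (m n : ℕ) (j : ℤ) : Matrix (Fin m × Fin n) (Fin n) ℂ :=
  fun p q => if ((p.1 : ℕ) : ℤ) + 1 = j ∧ p.2 = q then 1 else 0

/-- The matrix polynomial `P(λ) = Σ_{i=0}^m λ^i A_i` as an `n × n` matrix over `ℂ[λ]`. -/
noncomputable def polyP (m n : ℕ) (A : ℕ → Matrix (Fin n) (Fin n) ℂ) :
    Matrix (Fin n) (Fin n) (Polynomial ℂ) := fun p q =>
  ∑ i ∈ Finset.range (m + 1), Polynomial.C (A i p q) * Polynomial.X ^ i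

/-- The pencil `λ M₁ − M₀` as a matrix over `ℂ[λ]`. -/
noncomputable def pencilPoly {N : Type*} (M1 M0 : Matrix N N ℂ) : Matrix N N (Polynomial ℂ) :=
  fun p q => Polynomial.C (M1 p q) * Polynomial.X - Polynomial.C (M0 p q)

/-- The canonical embedding `ℂ[λ] → ℂ(λ)`. -/
noncomputable def toRF : Polynomial ℂ →+* RatFunc ℂ := algebraMap _ _

/-- A vector polynomial, viewed as a rational vector. -/
noncomputable def ratVec {β : Type*} (v : β → Polynomial ℂ) : β → RatFunc ℂ :=
  fun i => toRF (v i)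

/-- The degree of a vector polynomial: the maximum of the degrees of its entries. -/
noncomputable def vecDeg {β : Type*} [Fintype β] (v : β → Polynomial ℂ) : ℕ :=
  Finset.univ.sup fun i => (v i).natDegree

/-- The family `v` of vector polynomials is a polynomial basis of the right null space
`N_r(M) = {x : M x = 0}` of the rational matrix `M`. -/
def IsRightPolyBasis {α β : Type*} [Fintype β] (M : Matrix α β (RatFunc ℂ))
    {p : ℕ} (v : Fin p → β → Polynomial ℂ) : Prop :=
  (∀ j, M.mulVec (ratVec (v j)) = 0) ∧
  LinearIndependent (RatFunc ℂ) (fun j => ratVec (v j)) ∧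
  ∀ x : β → RatFunc ℂ, M.mulVec x = 0 →
    x ∈ Submodule.span (RatFunc ℂ) (Set.range fun j => ratVec (v j))

/-- The family `v` of vector polynomials is a polynomial basis of the left null space
`N_l(M) = {y : yᵀ M = 0}` of the rational matrix `M`. -/
def IsLeftPolyBasis {α β : Type*} [Fintype α] (M : Matrix α β (RatFunc ℂ))
    {p : ℕ} (v : Fin p → α → Polynomial ℂ) : Prop :=
  (∀ j, Matrix.vecMul (ratVec (v j)) M = 0) ∧
  LinearIndependent (RatFunc ℂ) (fun j => ratVec (v j)) ∧
  ∀ y : α → RatFunc ℂ, Matrix.vecMul y M = 0 →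
    y ∈ Submodule.span (RatFunc ℂ) (Set.range fun j => ratVec (v j))

/-- A right minimal basis: a polynomial basis of `N_r(M)` of minimal order. -/
def IsRightMinimalBasis {α β : Type*} [Fintype β] (M : Matrix α β (RatFunc ℂ))
    {p : ℕ} (v : Fin p → β → Polynomial ℂ) : Prop :=
  IsRightPolyBasis M v ∧
  ∀ (q : ℕ) (w : Fin q → β → Polynomial ℂ), IsRightPolyBasis M w →
    (∑ j, vecDeg (v j)) ≤ ∑ j, vecDeg (w j)

/-- A left minimal basis: a polynomial basis of `N_l(M)` of minimal order. -/
def IsLeftMinimalBasis {α β : Type*} [Fintype α] (M : Matrix α β (RatFunc ℂ))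
    {p : ℕ} (v : Fin p → α → Polynomial ℂ) : Prop :=
  IsLeftPolyBasis M v ∧
  ∀ (q : ℕ) (w : Fin q → α → Polynomial ℂ), IsLeftPolyBasis M w →
    (∑ j, vecDeg (v j)) ≤ ∑ j, vecDeg (w j)

/-- The columns of the matrix polynomial `Z` form a right minimal basis of `M`, ordered
with nondecreasing degrees. -/
def IsRightMinBasisMat {α β : Type*} [Fintype β] (M : Matrix α β (RatFunc ℂ))
    {p : ℕ} (Z : Matrix β (Fin p) (Polynomial ℂ)) : Prop :=
  IsRightMinimalBasis M (fun j i => Z i j) ∧ Monotone fun j => vecDeg (fun i => Z i j)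

/-- The columns of the matrix polynomial `Z` form a left minimal basis of `M`, ordered
with nondecreasing degrees. -/
def IsLeftMinBasisMat {α β : Type*} [Fintype α] (M : Matrix α β (RatFunc ℂ))
    {p : ℕ} (Z : Matrix α (Fin p) (Polynomial ℂ)) : Prop :=
  IsLeftMinimalBasis M (fun j i => Z i j) ∧ Monotone fun j => vecDeg (fun i => Z i j)

/-- `ε` is the (nondecreasing) list of right minimal indices of `M`. -/
def RightMinIndices {α β : Type*} [Fintype β] (M : Matrix α β (RatFunc ℂ))
    {p : ℕ} (ε : Fin p → ℤ) : Prop :=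
  ∃ v : Fin p → β → Polynomial ℂ, IsRightMinimalBasis M v ∧
    Monotone (fun j => vecDeg (v j)) ∧ ∀ j, (vecDeg (v j) : ℤ) = ε j

/-- `ε` is the (nondecreasing) list of left minimal indices of `M`. -/
def LeftMinIndices {α β : Type*} [Fintype α] (M : Matrix α β (RatFunc ℂ))
    {p : ℕ} (ε : Fin p → ℤ) : Prop :=
  ∃ v : Fin p → α → Polynomial ℂ, IsLeftMinimalBasis M v ∧
    Monotone (fun j => vecDeg (v j)) ∧ ∀ j, (vecDeg (v j) : ℤ) = ε j

open Classical in
/-- The total number of consecutions of a permutation `α` of `{0,…,m−1}`: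
the number of `i ∈ {0,…,m−2}` occurring to the left of `i+1` in `α`. -/
noncomputable def totalCons (m : ℕ) (α : List SIdx) : ℕ :=
  ((Finset.range (m - 1)).filter fun i => [SIdx.pos i, SIdx.pos (i + 1)].Sublist α).card

open Classical in
/-- The total number of inversions of a permutation `α` of `{0,…,m−1}`:
the number of `i ∈ {0,…,m−2}` occurring to the right of `i+1` in `α`. -/
noncomputable def totalInvs (m : ℕ) (α : List SIdx) : ℕ :=
  ((Finset.range (m - 1)).filter fun i => [SIdx.pos (i + 1), SIdx.pos i].Sublist α).card

namespace EGFPProof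

/-- Constant matrix acting on a vector polynomial. -/
noncomputable def act {α β : Type*} [Fintype β] (M : Matrix α β ℂ) (x : β → ℂ[X]) : α → ℂ[X] :=
  (M.map Polynomial.C) *ᵥ x

theorem act_mul {α β γ : Type*} [Fintype β] [Fintype γ] (M : Matrix α β ℂ) (N : Matrix β γ ℂ)
    (x : γ → ℂ[X]) : act (M * N) x = act M (act N x) := by
  simp [act, Matrix.map_mul]

theorem act_one {α : Type*} [Fintype α] [DecidableEq α] (x : α → ℂ[X]) :
    act (1 : Matrix α α ℂ) x = x := by
  simp [act]

theorem act_zero {α β : Type*} [Fintype β] (M : Matrix α β ℂ) :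
    act M (0 : β → ℂ[X]) = 0 := by
  simp [act]

theorem act_sub {α β : Type*} [Fintype β] (M : Matrix α β ℂ) (x y : β → ℂ[X]) :
    act M (x - y) = act M x - act M y := by
  simp [act, Matrix.mulVec_sub]

theorem act_smul {α β : Type*} [Fintype β] (M : Matrix α β ℂ) (c : ℂ[X]) (x : β → ℂ[X]) :
    act M (c • x) = c • act M x := by
  simp [act, Matrix.mulVec_smul]

theorem act_neg_left {α β : Type*} [Fintype β] (M : Matrix α β ℂ) (x : β → ℂ[X]) :
    act (-M) x = - act M x := by
  ext i
  simp [act, Matrix.mulVec, dotProduct]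

theorem act_ext {α : Type*} [Fintype α] [DecidableEq α] {M N : Matrix α α ℂ}
    (h : ∀ x, act M x = act N x) : M = N := by
  ext i j
  have := congrFun (h (Pi.single j 1)) i
  simpa [act] using this

/-- Block `k` (the block in 1-indexed position `m - k`). -/
noncomputable def blk {m n : ℕ} (x : Fin m × Fin n → ℂ[X]) (k : ℕ) : Fin n → ℂ[X] := fun i =>
  if h : m - 1 - k < m then x (⟨m - 1 - k, h⟩, i) else 0

theorem blk_ext {m n : ℕ} {x y : Fin m × Fin n → ℂ[X]} (h : ∀ k < m, blk x k = blk y k) :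
    x = y := by
  ext1 ⟨p, i⟩
  have := congrFun (h (m - 1 - p) (by omega)) i
  have e : m - 1 - (m - 1 - (p : ℕ)) = p := by omega
  simpa [blk, e] using this

theorem blk_act_one {m n : ℕ} (M : Matrix (Fin m × Fin n) (Fin m × Fin n) ℂ)
    (x : Fin m × Fin n → ℂ[X]) (k r : ℕ) (hk : k < m) (hr : r < m) (B : Matrix (Fin n) (Fin n) ℂ)
    (h : ∀ (p q : Fin m) (i j : Fin n), (p : ℕ) = m - 1 - k →
      M (p, i) (q, j) = if (q : ℕ) = m - 1 - r then B i j else 0) :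
    blk (act M x) k = act B (blk x r) := by
  ext1 i
  have h1 : m - 1 - k < m := by omega
  have h2 : m - 1 - r < m := by omega
  simp only [blk, h1, h2, dif_pos, act, Matrix.mulVec, dotProduct, Fintype.sum_prod_type,
    Matrix.map_apply]
  rw [Finset.sum_eq_single (⟨m - 1 - r, h2⟩ : Fin m)]
  · refine Finset.sum_congr rfl fun j _ => ?_
    rw [h _ _ _ _ rfl]; simp
  · intro q _ hq
    refine Finset.sum_eq_zero fun j _ => ?_
    rw [h _ _ _ _ rfl, if_neg (fun e => hq (Fin.ext e))]; simp
  · simp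

theorem blk_act_two {m n : ℕ} (M : Matrix (Fin m × Fin n) (Fin m × Fin n) ℂ)
    (x : Fin m × Fin n → ℂ[X]) (k r s : ℕ) (hk : k < m) (hr : r < m) (hs : s < m)
    (hrs : r ≠ s) (B D : Matrix (Fin n) (Fin n) ℂ)
    (h : ∀ (p q : Fin m) (i j : Fin n), (p : ℕ) = m - 1 - k →
      M (p, i) (q, j) = if (q : ℕ) = m - 1 - r then B i j else
        if (q : ℕ) = m - 1 - s then D i j else 0) :
    blk (act M x) k = act B (blk x r) + act D (blk x s) := by
  ext1 i
  have h1 : m - 1 - k < m := by omega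
  have h2 : m - 1 - r < m := by omega
  have h3 : m - 1 - s < m := by omega
  have hne : m - 1 - s ≠ m - 1 - r := by omega
  simp only [blk, h1, h2, h3, dif_pos, act, Matrix.mulVec, dotProduct, Fintype.sum_prod_type,
    Matrix.map_apply, Pi.add_apply]
  rw [Finset.sum_eq_add (⟨m - 1 - r, h2⟩ : Fin m) ⟨m - 1 - s, h3⟩]
  · congr 1
    · refine Finset.sum_congr rfl fun j _ => ?_
      rw [h _ _ _ _ rfl]; simp
    · refine Finset.sum_congr rfl fun j _ => ?_
      rw [h _ _ _ _ rfl]; simp [hne]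
  · intro e; simp only [Fin.mk.injEq] at e; omega
  · intro q _ hq
    refine Finset.sum_eq_zero fun j _ => ?_
    rw [h _ _ _ _ rfl, if_neg (fun e => hq.1 (Fin.ext e)), if_neg (fun e => hq.2 (Fin.ext e))]
    simp
  · simp
  · simp

variable {m n : ℕ}

theorem gate_other (t : SIdx) (ht : t.val ≤ m) (Y : Matrix (Fin n) (Fin n) ℂ)
    (x : Fin m × Fin n → ℂ[X]) (k : ℕ) (hk : k < m) (h1 : t.val ≠ k) (h2 : t.val ≠ k + 1) :
    blk (act (elemMat m n t Y) x) k = blk x k := by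
  rw [blk_act_one _ _ k k hk hk 1, act_one]
  intro p q i j hp
  simp only [elemMat, Matrix.one_apply, Fin.ext_iff, Prod.ext_iff]
  split_ifs <;> first | rfl | omega | (exfalso; tauto) | skip

theorem gate_top (k : ℕ) (hk : k < m) (hm : 2 ≤ m) (Y : Matrix (Fin n) (Fin n) ℂ)
    (x : Fin m × Fin n → ℂ[X]) :
    blk (act (elemMat m n (.pos k) Y) x) k =
      act Y (blk x k) + (if k = 0 then 0 else blk x (k - 1)) := by
  by_cases h0 : k = 0
  · subst h0
    rw [blk_act_one _ _ 0 0 hk hk Y]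
    · simp
    intro p q i j hp
    simp only [elemMat, SIdx.val, Fin.ext_iff]
    split_ifs <;> first | rfl | omega | (exfalso; tauto)
  · rw [if_neg h0, blk_act_two _ _ k k (k-1) hk hk (by omega) (by omega) Y 1, act_one]
    intro p q i j hp
    simp only [elemMat, SIdx.val, SIdx.isNeg, Matrix.one_apply, Fin.ext_iff, Prod.ext_iff]
    split_ifs <;> first | rfl | omega | (exfalso; tauto)

theorem gate_bot (k : ℕ) (hk : k + 1 < m) (Y : Matrix (Fin n) (Fin n) ℂ)
    (x : Fin m × Fin n → ℂ[X]) :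
    blk (act (elemMat m n (.pos (k + 1)) Y) x) k = blk x (k + 1) := by
  rw [blk_act_one _ _ k (k + 1) (by omega) hk 1, act_one]
  intro p q i j hp
  simp only [elemMat, SIdx.val, SIdx.isNeg, Matrix.one_apply, Fin.ext_iff, Prod.ext_iff]
  split_ifs <;> first | rfl | omega | (exfalso; tauto)

theorem ngate_top (k : ℕ) (hk : k + 1 < m) (Y : Matrix (Fin n) (Fin n) ℂ)
    (x : Fin m × Fin n → ℂ[X]) :
    blk (act (elemMat m n (.neg (k + 1)) Y) x) (k + 1) = blk x k := by
  rw [blk_act_one _ _ (k+1) k hk (by omega) 1, act_one]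
  intro p q i j hp
  simp only [elemMat, SIdx.val, SIdx.isNeg, Matrix.one_apply, Fin.ext_iff, Prod.ext_iff]
  split_ifs <;> first | rfl | omega | (exfalso; tauto)

theorem ngate_bot (k : ℕ) (hk : k + 1 < m) (Y : Matrix (Fin n) (Fin n) ℂ)
    (x : Fin m × Fin n → ℂ[X]) :
    blk (act (elemMat m n (.neg (k + 1)) Y) x) k = blk x (k + 1) + act Y (blk x k) := by
  rw [blk_act_two _ _ k (k+1) k (by omega) (by omega) (by omega) (by omega) 1 Y, act_one]
  intro p q i j hp
  simp only [elemMat, SIdx.val, SIdx.isNeg, Matrix.one_apply, Fin.ext_iff, Prod.ext_iff]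
  split_ifs <;> first | rfl | omega | (exfalso; tauto) | simp_all

theorem gate_m (t : SIdx) (ht : t.val = m) (hm : 2 ≤ m) (Y : Matrix (Fin n) (Fin n) ℂ)
    (x : Fin m × Fin n → ℂ[X]) :
    blk (act (elemMat m n t Y) x) (m - 1) = act Y (blk x (m - 1)) := by
  rw [blk_act_one _ _ (m-1) (m-1) (by omega) (by omega) Y]
  intro p q i j hp
  simp only [elemMat, ht, Fin.ext_iff]
  split_ifs <;> first | rfl | omega | (exfalso; tauto)

theorem gate_zero (t : SIdx) (ht : t.val = 0) (hm : 2 ≤ m) (Y : Matrix (Fin n) (Fin n) ℂ)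
    (x : Fin m × Fin n → ℂ[X]) :
    blk (act (elemMat m n t Y) x) 0 = act Y (blk x 0) := by
  rw [blk_act_one _ _ 0 0 (by omega) (by omega) Y]
  intro p q i j hp
  simp only [elemMat, ht, Fin.ext_iff]
  split_ifs <;> first | rfl | omega | (exfalso; tauto)

theorem pos_neg (k : ℕ) (hk : k + 1 < m) (Y : Matrix (Fin n) (Fin n) ℂ) :
    elemMat m n (.pos (k+1)) (-Y) * elemMat m n (.neg (k+1)) Y = 1 := by
  refine act_ext fun x => ?_
  rw [act_mul, act_one]
  refine blk_ext fun j hj => ?_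
  by_cases h1 : j = k + 1
  · subst h1
    rw [gate_top _ hk (by omega), if_neg (by omega)]
    simp only [Nat.add_sub_cancel, ngate_top _ hk, ngate_bot _ hk, act_neg_left]
    abel
  by_cases h2 : j = k
  · subst h2
    rw [gate_bot _ hk, ngate_top _ hk]
  rw [gate_other, gate_other] <;> (try simp only [SIdx.val]) <;> omega

theorem neg_pos (k : ℕ) (hk : k + 1 < m) (Y : Matrix (Fin n) (Fin n) ℂ) :
    elemMat m n (.neg (k+1)) Y * elemMat m n (.pos (k+1)) (-Y) = 1 :=
  mul_eq_one_comm.mp (pos_neg k hk Y)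

theorem isUnit_elemMat (t : SIdx) (ht : t.val ≤ m) (hm : 2 ≤ m) (Y : Matrix (Fin n) (Fin n) ℂ)
    (h : t.val = 0 ∨ t.val = m → IsUnit Y) : IsUnit (elemMat m n t Y) := by
  have key : ∀ N, elemMat m n t Y * N = 1 → IsUnit (elemMat m n t Y) := fun N hN =>
    ⟨⟨_, N, hN, mul_eq_one_comm.mp hN⟩, rfl⟩
  by_cases h0 : t.val = 0
  · obtain ⟨u, hu⟩ := h (.inl h0)
    refine key (elemMat m n t (u⁻¹).1) (act_ext fun x => ?_)
    rw [act_mul, act_one]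
    refine blk_ext fun j hj => ?_
    by_cases h1 : j = 0
    · subst h1
      rw [gate_zero _ h0 hm, gate_zero _ h0 hm, ← act_mul, ← hu, Units.mul_inv, act_one]
    rw [gate_other, gate_other] <;> omega
  by_cases h0' : t.val = m
  · obtain ⟨u, hu⟩ := h (.inr h0')
    refine key (elemMat m n t (u⁻¹).1) (act_ext fun x => ?_)
    rw [act_mul, act_one]
    refine blk_ext fun j hj => ?_
    by_cases h1 : j = m - 1
    · subst h1
      rw [gate_m _ h0' hm, gate_m _ h0' hm, ← act_mul, ← hu, Units.mul_inv, act_one]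
    rw [gate_other, gate_other] <;> omega
  cases t with
  | pos k =>
    simp only [SIdx.val] at *
    obtain ⟨k, rfl⟩ := Nat.exists_eq_succ_of_ne_zero h0
    have := pos_neg (m := m) k (by omega) (-Y)
    rw [neg_neg] at this
    exact key _ this
  | neg k =>
    simp only [SIdx.val] at *
    obtain ⟨k, rfl⟩ := Nat.exists_eq_succ_of_ne_zero h0
    exact key _ (neg_pos (m := m) k (by omega) Y)

/-- Product of elementary matrices along a list of (index, matrix) pairs. -/
noncomputable def pp (m n : ℕ) (l : List (SIdx × Matrix (Fin n) (Fin n) ℂ)) :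
    Matrix (Fin m × Fin n) (Fin m × Fin n) ℂ :=
  (l.map fun p => elemMat m n p.1 p.2).prod

theorem pp_nil : pp m n [] = 1 := rfl

theorem pp_cons (p : SIdx × Matrix (Fin n) (Fin n) ℂ) (l) :
    pp m n (p :: l) = elemMat m n p.1 p.2 * pp m n l := by simp [pp]

theorem pp_append (l l') : pp m n (l ++ l') = pp m n l * pp m n l' := by simp [pp]

theorem pp_untouched (l : List (SIdx × Matrix (Fin n) (Fin n) ℂ)) (k : ℕ) (hk : k < m)
    (h : ∀ p ∈ l, p.1.val ≤ m ∧ p.1.val ≠ k ∧ p.1.val ≠ k + 1) (x : Fin m × Fin n → ℂ[X]) :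
    blk (act (pp m n l) x) k = blk x k := by
  induction l with
  | nil => rw [pp_nil, act_one]
  | cons p l ih =>
    have hp := h p (by simp)
    rw [pp_cons, act_mul, gate_other _ hp.1 _ _ _ hk hp.2.1 hp.2.2,
      ih fun q hq => h q (by simp [hq])]

theorem isUnit_pp (hm : 2 ≤ m) (l : List (SIdx × Matrix (Fin n) (Fin n) ℂ))
    (h : ∀ p ∈ l, p.1.val ≤ m ∧ (p.1.val = 0 ∨ p.1.val = m → IsUnit p.2)) :
    IsUnit (pp m n l) := by
  induction l with
  | nil => rw [pp_nil]; exact isUnit_one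
  | cons p l ih =>
    rw [pp_cons]
    exact (isUnit_elemMat _ (h p (by simp)).1 hm _ (h p (by simp)).2).mul
      (ih fun q hq => h q (by simp [hq]))

/-! ### Scanning -/

/-- Greedy scan for an increasing chain. -/
def scan : ℕ → List SIdx → ℕ
  | k, [] => k
  | k, t :: l => if t = .pos (k + 1) then scan (k + 1) l else scan k l

theorem SIP_split {α : List SIdx} (h : SIP α) {p q r : List SIdx} {a : SIdx}
    (e : α = p ++ a :: (q ++ a :: r)) : a.succ ∈ q := by
  subst e
  obtain ⟨c, h1, h2, h3⟩ := h ⟨p.length, by simp⟩ ⟨p.length + 1 + q.length, by simp; omega⟩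
    (by simp [Fin.lt_def]; omega) (by
      simp only [List.get_eq_getElem]
      rw [List.getElem_append_right (by omega), List.getElem_append_right (by omega)]
      simp only [Nat.sub_self, List.getElem_cons_zero]
      have : p.length + 1 + q.length - p.length = q.length + 1 := by omega
      simp [this])
  simp only [Fin.lt_def, List.get_eq_getElem] at h1 h2 h3
  rw [List.getElem_append_right (by omega)] at h3
  obtain ⟨d, hd⟩ : ∃ d, (c : ℕ) - p.length = d + 1 := ⟨c - p.length - 1, by omega⟩
  simp only [hd, List.getElem_cons_succ] at h3
  rw [List.getElem_append_left (by omega)] at h3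
  simp only [Nat.sub_self, List.getElem_append_right (le_refl p.length),
    List.getElem_cons_zero] at h3
  rw [← h3]; exact List.getElem_mem _

theorem SIP_of_split {α : List SIdx}
    (h : ∀ (p q r : List SIdx) (a : SIdx), α = p ++ a :: (q ++ a :: r) → a.succ ∈ q) :
    SIP α := by
  intro a b hab e
  have hb := b.2
  have hab' : (a : ℕ) < b := hab
  have e1 : α = α.take a ++ α[(a:ℕ)] :: ((α.drop (a + 1)).take (b - (a + 1)) ++
      α[(b:ℕ)] :: α.drop (b + 1)) := by
    conv_lhs => rw [← List.take_append_drop a α, List.drop_eq_getElem_cons (by omega),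
      ← List.take_append_drop (b - (a + 1)) (α.drop (a + 1)), List.drop_drop]
    rw [show (a : ℕ) + 1 + (b - (a + 1)) = b by omega,
      List.drop_eq_getElem_cons (i := (b : ℕ)) (by omega)]
  simp only [List.get_eq_getElem] at e
  rw [← e] at e1
  have := h _ _ _ _ e1
  rw [List.mem_iff_getElem] at this
  obtain ⟨i, hi, hi'⟩ := this
  simp only [List.length_take, List.length_drop] at hi
  refine ⟨⟨a + 1 + i, by omega⟩, by simp [Fin.lt_def]; omega, by simp [Fin.lt_def]; omega, ?_⟩
  simpa using hi'

theorem SIP_reverse {α : List SIdx} (h : SIP α) : SIP α.reverse := by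
  refine SIP_of_split fun p q r a e => ?_
  have e2 := congrArg List.reverse e
  rw [List.reverse_reverse] at e2
  have := SIP_split h (p := r.reverse) (q := q.reverse) (r := p.reverse) (a := a)
    (by rw [e2]; simp)
  simpa using this

theorem scan_blk (l : List (SIdx × Matrix (Fin n) (Fin n) ℂ)) (k : ℕ) (hk : k < m)
    (hl : ∀ p ∈ l, p.1.val < m ∧ p.1.isNeg = false)
    (hs : ∀ p q r a, l.map Prod.fst = p ++ a :: (q ++ a :: r) → a.succ ∈ q)
    (hf : ∀ p r, l.map Prod.fst = p ++ .pos k :: r → SIdx.pos (k + 1) ∈ p)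
    (w : Fin m × Fin n → ℂ[X]) :
    blk (act (pp m n l) w) k = blk w (scan k (l.map Prod.fst)) := by
  induction l generalizing k with
  | nil => rw [pp_nil, act_one]; rfl
  | cons t l ih =>
    obtain ⟨t, Y⟩ := t
    have ht := hl (t, Y) (by simp)
    have hl' : ∀ p ∈ l, p.1.val < m ∧ p.1.isNeg = false := fun p hp => hl p (by simp [hp])
    have hs' : ∀ p q r a, l.map Prod.fst = p ++ a :: (q ++ a :: r) → a.succ ∈ q :=
      fun p q r a e => hs (t :: p) q r a (by simp [e])
    rw [pp_cons, act_mul]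
    cases t with
    | neg j => simp [SIdx.isNeg] at ht
    | pos j =>
      simp only [SIdx.val] at ht
      simp only [List.map_cons, scan, SIdx.pos.injEq]
      by_cases hj : j = k + 1
      · subst hj
        rw [if_pos rfl, gate_bot _ ht.1]
        refine ih (k + 1) ht.1 hl' hs' fun p r e => ?_
        exact hs [] p r (.pos (k + 1)) (by simp [e])
      · rw [if_neg hj]
        have hjk : j ≠ k := by
          rintro rfl
          simpa using hf [] (l.map Prod.fst) (by simp)
        rw [gate_other (.pos j) (by simp only [SIdx.val]; omega) _ _ _ hk hjk (by simpa [SIdx.val] using hj)]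
        refine ih k hk hl' hs' fun p r e => ?_
        have := hf (.pos j :: p) r (by simp [e])
        simp only [List.mem_cons, SIdx.pos.injEq] at this
        rcases this with h | h
        · omega
        · exact h

theorem chain_scan (l : List SIdx) (k p : ℕ) :
    (chainUp (.pos k) p).Sublist (.pos k :: l) ↔ k + p ≤ scan k l := by
  have hmono : ∀ (l : List SIdx) k, k ≤ scan k l := by
    intro l
    induction l with
    | nil => intro k; exact le_rfl
    | cons t l ih =>
      intro k; simp only [scan]; split_ifs
      · exact (Nat.le_succ k).trans (ih _)
      · exact ih _
  induction l generalizing k p with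
  | nil =>
    cases p with
    | zero => simp [chainUp, scan]
    | succ p =>
      simp only [chainUp, scan, List.cons_sublist_cons, List.sublist_nil]
      cases p <;> simp [chainUp]
  | cons t l ih =>
    cases p with
    | zero => simpa [chainUp] using hmono _ _
    | succ p =>
      simp only [chainUp, scan, List.cons_sublist_cons, SIdx.succ]
      by_cases ht : t = .pos (k + 1)
      · subst ht
        rw [if_pos rfl]
        refine (ih (k + 1) p).trans ?_
        rw [Nat.add_right_comm, Nat.add_assoc]
      · rw [if_neg ht]
        refine Iff.trans ?_ (ih k (p + 1))
        simp only [chainUp, List.cons_sublist_cons, SIdx.succ]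
        cases p with
        | zero => simp [chainUp, Ne.symm ht]
        | succ p =>
          simp only [chainUp]
          exact ⟨fun h => by
            cases h with
            | cons _ h => exact h
            | cons_cons _ h => exact absurd rfl ht, fun h => h.cons _⟩

theorem chain_drop (pre l : List SIdx) (t : SIdx) (h : t ∉ pre) (p : ℕ) :
    (chainUp t p).Sublist (pre ++ l) ↔ (chainUp t p).Sublist l := by
  induction pre with
  | nil => simp
  | cons a pre ih =>
    simp only [List.mem_cons, not_or] at h
    rw [← ih h.2]
    obtain ⟨s, hs⟩ : ∃ s, chainUp t p = t :: s := by cases p <;> exact ⟨_, rfl⟩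
    rw [hs]
    refine ⟨fun hh => ?_, fun hh => hh.cons _⟩
    cases hh with
    | cons _ h => exact h
    | cons_cons _ h' => exact absurd rfl h.1

theorem length_chainUp (t : SIdx) (p : ℕ) : (chainUp t p).length = p + 1 := by
  induction p generalizing t with
  | zero => rfl
  | succ p ih => simp [chainUp, ih]

theorem consAt_eq_scan (pre l : List SIdx) (h : SIdx.pos 0 ∉ pre) :
    consAt (pre ++ .pos 0 :: l) (.pos 0) = (scan 0 l : ℤ) := by
  have key : ∀ p, (chainUp (.pos 0) p).Sublist (pre ++ .pos 0 :: l) ↔ p ≤ scan 0 l := by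
    intro p; rw [chain_drop _ _ _ h, chain_scan, zero_add]
  unfold consAt
  rw [if_pos (by simp)]
  congr 1
  let _ := Classical.decPred
    (fun p : ℕ => (chainUp (.pos 0) p).Sublist (pre ++ SIdx.pos 0 :: l))
  rw [Nat.findGreatest_eq_iff]
  refine ⟨?_, fun _ => (key _).2 le_rfl, fun p hp _ hh => ?_⟩
  · have := ((key _).2 le_rfl).length_le
    rw [length_chainUp] at this; omega
  · have := (key _).1 hh; omega

theorem scan_mem (l : List SIdx) (k : ℕ) : SIdx.pos (scan k l) ∈ SIdx.pos k :: l := by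
  induction l generalizing k with
  | nil => simp [scan]
  | cons t l ih =>
    simp only [scan]
    split_ifs with h
    · subst h; exact List.mem_cons_of_mem _ (ih _)
    · have := ih k
      simp only [List.mem_cons] at this ⊢; tauto

/-! ### Fiedler pencils: the wire diagram -/

/-- Fiedler pairs for a list of nonnegative indices. -/
def fp (A : ℕ → Matrix (Fin n) (Fin n) ℂ) (L : List ℕ) :
    List (SIdx × Matrix (Fin n) (Fin n) ℂ) := L.map fun k => (SIdx.pos k, -A k)

/-- The part of the list after the first occurrence of `k`. -/
def after (k : ℕ) (L : List ℕ) : List ℕ := (L.dropWhile (fun j => decide (j ≠ k))).tail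

theorem after_split (p r : List ℕ) (k : ℕ) (h : k ∉ p) : after k (p ++ k :: r) = r := by
  induction p with
  | nil => simp [after]
  | cons a p ih =>
    simp only [List.mem_cons, not_or] at h
    have := ih h.2
    simp only [after] at this ⊢
    rw [List.cons_append, List.dropWhile_cons_of_pos (by simpa using Ne.symm h.1)]
    exact this

noncomputable def aV (A : ℕ → Matrix (Fin n) (Fin n) ℂ) (L : List ℕ) (z : Fin m × Fin n → ℂ[X])
    (k : ℕ) : Fin n → ℂ[X] := blk (act (pp m n (fp A (after k L))) z) k

noncomputable def bV (A : ℕ → Matrix (Fin n) (Fin n) ℂ) (L : List ℕ) (z : Fin m × Fin n → ℂ[X])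
    (k : ℕ) : Fin n → ℂ[X] :=
  if k = 0 then 0 else blk (act (pp m n (fp A (after k L))) z) (k - 1)

theorem fp_append (A : ℕ → Matrix (Fin n) (Fin n) ℂ) (L L' : List ℕ) :
    fp A (L ++ L') = fp A L ++ fp A L' := by simp [fp]

theorem fp_cons (A : ℕ → Matrix (Fin n) (Fin n) ℂ) (k : ℕ) (L' : List ℕ) :
    fp A (k :: L') = (SIdx.pos k, -A k) :: fp A L' := by simp [fp]

theorem fp_untouched (A : ℕ → Matrix (Fin n) (Fin n) ℂ) (L : List ℕ) (k : ℕ) (hk : k < m)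
    (h : ∀ j ∈ L, j < m) (h1 : k ∉ L) (h2 : k + 1 ∉ L) (x : Fin m × Fin n → ℂ[X]) :
    blk (act (pp m n (fp A L)) x) k = blk x k := by
  refine pp_untouched _ _ hk ?_ x
  intro p hp
  simp only [fp, List.mem_map] at hp
  obtain ⟨j, hj, rfl⟩ := hp
  simp only [SIdx.val]
  exact ⟨(h j hj).le, fun e => h1 (e ▸ hj), fun e => h2 (e ▸ hj)⟩

theorem wire_cons (hm : 2 ≤ m) (A : ℕ → Matrix (Fin n) (Fin n) ℂ) (p q r : List ℕ) (k : ℕ)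
    (hk : k + 1 < m)
    (hL : ∀ j ∈ p ++ k :: (q ++ (k + 1) :: r), j < m) (hn : (p ++ k :: (q ++ (k + 1) :: r)).Nodup)
    (z : Fin m × Fin n → ℂ[X]) :
    aV A (p ++ k :: (q ++ (k + 1) :: r)) z k = aV A (p ++ k :: (q ++ (k + 1) :: r)) z (k + 1) ∧
    bV A (p ++ k :: (q ++ (k + 1) :: r)) z (k + 1) = blk z k ∧
    blk (act (pp m n (fp A (p ++ k :: (q ++ (k + 1) :: r)))) z) k =
      act (-A k) (aV A (p ++ k :: (q ++ (k + 1) :: r)) z k) +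
      bV A (p ++ k :: (q ++ (k + 1) :: r)) z k := by
  simp only [List.nodup_append, List.nodup_cons, List.mem_append, List.mem_cons, not_or] at hn
  simp only [List.mem_append, List.mem_cons] at hL
  have hp1 : k ∉ p := fun h => hn.2.2 _ h k (by simp) rfl
  have hp2 : k + 1 ∉ p := fun h => hn.2.2 _ h (k + 1) (by simp) rfl
  have hq1 : k ∉ q := hn.2.1.1.1
  have hq2 : k + 1 ∉ q := fun h => hn.2.1.2.2.2 _ h (k + 1) (by simp) rfl
  have hr1 : k ∉ r := hn.2.1.1.2.2
  have hr2 : k + 1 ∉ r := hn.2.1.2.2.1.1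
  have e1 := after_split p (q ++ (k + 1) :: r) k hp1
  have e2 := after_split (p ++ k :: q) r (k + 1) (by simp [hp2, hq2])
  rw [List.append_assoc, List.cons_append] at e2
  simp only [aV, bV, e1, e2]
  have hk' : k < m := by omega
  refine ⟨?_, ?_, ?_⟩
  · rw [fp_append, pp_append, act_mul, fp_untouched A q k hk' (by intro j hj; exact hL j (by tauto)) hq1 hq2, fp_cons, pp_cons,
      act_mul, gate_bot _ hk]
  · rw [if_neg (by omega), Nat.add_sub_cancel, fp_untouched A r k hk' (by intro j hj; exact hL j (by tauto)) hr1 hr2]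
  · rw [fp_append, pp_append, act_mul, fp_untouched A p k hk' (by intro j hj; exact hL j (by tauto)) hp1 hp2, fp_cons, pp_cons,
      act_mul, gate_top _ hk' hm]

theorem wire_inv (hm : 2 ≤ m) (A : ℕ → Matrix (Fin n) (Fin n) ℂ) (p q r : List ℕ) (k : ℕ)
    (hk : k + 1 < m)
    (hL : ∀ j ∈ p ++ (k + 1) :: (q ++ k :: r), j < m) (hn : (p ++ (k + 1) :: (q ++ k :: r)).Nodup)
    (z : Fin m × Fin n → ℂ[X]) :
    aV A (p ++ (k + 1) :: (q ++ k :: r)) z k = blk z k ∧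
    bV A (p ++ (k + 1) :: (q ++ k :: r)) z (k + 1) =
      act (-A k) (aV A (p ++ (k + 1) :: (q ++ k :: r)) z k) +
      bV A (p ++ (k + 1) :: (q ++ k :: r)) z k ∧
    blk (act (pp m n (fp A (p ++ (k + 1) :: (q ++ k :: r)))) z) k =
      aV A (p ++ (k + 1) :: (q ++ k :: r)) z (k + 1) := by
  simp only [List.nodup_append, List.nodup_cons, List.mem_append, List.mem_cons, not_or] at hn
  simp only [List.mem_append, List.mem_cons] at hL
  have hp1 : k ∉ p := fun h => hn.2.2 _ h k (by simp) rfl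
  have hp2 : k + 1 ∉ p := fun h => hn.2.2 _ h (k + 1) (by simp) rfl
  have hq2 : k + 1 ∉ q := hn.2.1.1.1
  have hq1 : k ∉ q := fun h => hn.2.1.2.2.2 _ h k (by simp) rfl
  have hr2 : k + 1 ∉ r := hn.2.1.1.2.2
  have hr1 : k ∉ r := hn.2.1.2.2.1.1
  have e1 := after_split p (q ++ k :: r) (k + 1) hp2
  have e2 := after_split (p ++ (k + 1) :: q) r k (by simp [hp1, hq1])
  rw [List.append_assoc, List.cons_append] at e2
  simp only [aV, bV, e1, e2]
  have hk' : k < m := by omega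
  refine ⟨?_, ?_, ?_⟩
  · rw [fp_untouched A r k hk' (by intro j hj; exact hL j (by tauto)) hr1 hr2]
  · rw [if_neg (by omega), Nat.add_sub_cancel, fp_append, pp_append, act_mul,
      fp_untouched A q k hk' (by intro j hj; exact hL j (by tauto)) hq1 hq2, fp_cons, pp_cons, act_mul, gate_top _ hk' hm]
  · rw [fp_append, pp_append, act_mul, fp_untouched A p k hk' (by intro j hj; exact hL j (by tauto)) hp1 hp2, fp_cons, pp_cons,
      act_mul, gate_bot _ hk]

theorem wire_last (hm : 2 ≤ m) (A : ℕ → Matrix (Fin n) (Fin n) ℂ) (L : List ℕ)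
    (hL : ∀ j ∈ L, j < m) (hn : L.Nodup) (hmem : m - 1 ∈ L) (z : Fin m × Fin n → ℂ[X]) :
    aV A L z (m - 1) = blk z (m - 1) ∧
    blk (act (pp m n (fp A L)) z) (m - 1) =
      act (-A (m - 1)) (aV A L z (m - 1)) + bV A L z (m - 1) := by
  obtain ⟨p, r, rfl⟩ := List.append_of_mem hmem
  simp only [List.nodup_append, List.nodup_cons] at hn
  simp only [List.mem_append, List.mem_cons] at hL
  have hp1 : m - 1 ∉ p := fun h => hn.2.2 _ h (m - 1) (by simp) rfl
  have hr1 : m - 1 ∉ r := hn.2.1.1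
  have hp2 : m - 1 + 1 ∉ p := fun h => by have := hL _ (.inl h); omega
  have hr2 : m - 1 + 1 ∉ r := fun h => by have := hL _ (.inr (.inr h)); omega
  simp only [aV, bV, after_split p r (m - 1) hp1]
  have hk' : m - 1 < m := by omega
  constructor
  · rw [fp_untouched A r _ hk' (by intro j hj; exact hL j (by tauto)) hr1 hr2]
  · rw [fp_append, pp_append, act_mul, fp_untouched A p _ hk' (by intro j hj; exact hL j (by tauto)) hp1 hp2, fp_cons, pp_cons,
      act_mul, gate_top _ hk' hm]

/-- The inversion predicate. -/
def Inv (L : List ℕ) (k : ℕ) : Prop := [k + 1, k].Sublist L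

theorem split_cases (L : List ℕ) (hn : L.Nodup) (k : ℕ) (h1 : k ∈ L) (h2 : k + 1 ∈ L) :
    (¬ Inv L k ∧ ∃ p q r, L = p ++ k :: (q ++ (k + 1) :: r)) ∨
    (Inv L k ∧ ∃ p q r, L = p ++ (k + 1) :: (q ++ k :: r)) := by
  obtain ⟨p, r, rfl⟩ := List.append_of_mem h1
  have hn' := hn
  simp only [List.nodup_append, List.nodup_cons] at hn'
  simp only [List.mem_append, List.mem_cons] at h2
  rcases h2 with h | h | h
  · obtain ⟨s, t, rfl⟩ := List.append_of_mem h
    right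
    refine ⟨?_, s, t, r, by simp⟩
    unfold Inv
    rw [List.append_assoc, List.cons_append]
    refine List.Sublist.trans (List.Sublist.cons_cons _ ?_) (List.sublist_append_right _ _)
    exact List.Sublist.trans (List.Sublist.cons_cons _ (List.nil_sublist _))
      (List.sublist_append_right _ _)
  · omega
  · obtain ⟨s, t, rfl⟩ := List.append_of_mem h
    left
    refine ⟨fun hi => ?_, p, s, t, rfl⟩
    have h3 : [k, k + 1].Sublist (p ++ k :: (s ++ (k + 1) :: t)) := by
      refine List.Sublist.trans (List.Sublist.cons_cons _ ?_) (List.sublist_append_right _ _)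
      exact List.Sublist.trans (List.Sublist.cons_cons _ (List.nil_sublist _))
        (List.sublist_append_right _ _)
    unfold Inv at hi
    have hp : k ∉ p := fun h => hn'.2.2 _ h k (by simp) rfl
    have hp2 : k + 1 ∉ p := fun h => hn'.2.2 _ h (k + 1) (by simp) rfl
    obtain ⟨l1, l2, e, h4, h5⟩ := List.sublist_append_iff.1 hi
    cases l1 with
    | cons a l1 =>
      simp only [List.cons_append, List.cons.injEq] at e
      exact hp2 (e.1 ▸ h4.subset (by simp))
    | nil =>
      simp only [List.nil_append] at e
      subst e
      cases h5 with
      | cons _ h6 => exact hn'.2.1.1 (h6.subset (by simp))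

/-! ### The abstract recursion -/

section recursion
open Classical

variable (A : ℕ → Matrix (Fin n) (Fin n) ℂ) (inv : ℕ → Prop)

theorem polyP_mulVec (v : Fin n → ℂ[X]) :
    polyP m n A *ᵥ v = ∑ i ∈ Finset.range (m + 1), (X : ℂ[X]) ^ i • act (A i) v := by
  ext1 p
  simp only [Matrix.mulVec, dotProduct, polyP, act, Finset.sum_apply, Pi.smul_apply, smul_eq_mul,
    Matrix.map_apply, Finset.sum_mul, Finset.mul_sum]
  rw [Finset.sum_comm]
  refine Finset.sum_congr rfl fun i _ => Finset.sum_congr rfl fun j _ => ?_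
  ring

theorem count_add (k : ℕ) : Nat.count inv k + Nat.count (fun j => ¬ inv j) k = k := by
  induction k with
  | zero => simp
  | succ k ih =>
    rw [Nat.count_succ, Nat.count_succ]
    by_cases h : inv k
    · simp only [h, if_true, not_true_eq_false, if_false]; omega
    · simp only [h, if_true, not_false_eq_true, if_false]; omega

/-- The recursion satisfied by the wires of a Fiedler pencil's null vector. -/
structure Sys (m : ℕ) (a b z : ℕ → Fin n → ℂ[X]) : Prop where
  b0 : b 0 = 0
  cons : ∀ k, k + 1 < m → ¬ inv k → a k = a (k + 1) ∧ b (k + 1) = z k ∧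
    (X : ℂ[X]) • z k = act (-A k) (a k) + b k
  inv : ∀ k, k + 1 < m → inv k → a k = z k ∧ b (k + 1) = act (-A k) (a k) + b k ∧
    (X : ℂ[X]) • z k = a (k + 1)
  last : a (m - 1) = z (m - 1)
  last' : (X : ℂ[X]) • act (A m) (z (m - 1)) = act (-A (m - 1)) (a (m - 1)) + b (m - 1)

variable {A inv}
variable {a b z : ℕ → Fin n → ℂ[X]}

theorem Sys.a_eq (h : Sys A inv m a b z) (k : ℕ) (hk : k < m) :
    a k = (X : ℂ[X]) ^ Nat.count inv k • a 0 := by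
  induction k with
  | zero => simp
  | succ k ih =>
    have ih := ih (by omega)
    rw [Nat.count_succ]
    by_cases hi : inv k
    · obtain ⟨h1, h2, h3⟩ := h.inv k hk hi
      rw [← h3, ← h1, ih, smul_smul, if_pos hi, pow_succ']
    · obtain ⟨h1, h2, h3⟩ := h.cons k hk hi
      rw [← h1, ih, if_neg hi, add_zero]

theorem Sys.b_eq (h : Sys A inv m a b z) (k : ℕ) (hk : k < m) :
    (X : ℂ[X]) ^ Nat.count (fun j => ¬ inv j) k • b k +
      ∑ i ∈ Finset.range k, (X : ℂ[X]) ^ i • act (A i) (a 0) = 0 := by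
  induction k with
  | zero => simp [h.b0]
  | succ k ih =>
    have ih := ih (by omega)
    have key : (X : ℂ[X]) ^ Nat.count (fun j => ¬ inv j) k • act (-A k) (a k) =
        - ((X : ℂ[X]) ^ k • act (A k) (a 0)) := by
      rw [h.a_eq k (by omega), act_neg_left, act_smul, smul_neg, smul_smul, ← pow_add,
        add_comm, count_add]
    have key2 : (X : ℂ[X]) ^ Nat.count (fun j => ¬ inv j) (k + 1) • b (k + 1) =
        (X : ℂ[X]) ^ Nat.count (fun j => ¬ inv j) k • (act (-A k) (a k) + b k) := by
      rw [Nat.count_succ]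
      by_cases hi : inv k
      · obtain ⟨h1, h2, h3⟩ := h.inv k hk hi
        rw [if_neg (by simpa using hi), h2, add_zero]
      · obtain ⟨h1, h2, h3⟩ := h.cons k hk hi
        rw [if_pos hi, h2, ← h3, smul_smul, pow_succ]
    rw [key2, smul_add, key, Finset.sum_range_succ, ← ih]
    abel

theorem Sys.ker (hm : 2 ≤ m) (h : Sys A inv m a b z) : polyP m n A *ᵥ (a 0) = 0 := by
  rw [polyP_mulVec]
  obtain ⟨k, rfl⟩ : ∃ k, m = k + 1 := ⟨m - 1, by omega⟩
  have hb := h.b_eq k (by omega)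
  have hl := congrArg ((X : ℂ[X]) ^ Nat.count (fun j => ¬ inv j) k • ·) h.last'
  simp only [Nat.add_sub_cancel] at hl
  have hz := h.last
  simp only [Nat.add_sub_cancel] at hz
  have hc := count_add inv k
  rw [← hz, h.a_eq k (by omega), act_neg_left, act_smul, act_smul, smul_smul, smul_smul, smul_add,
    smul_neg, smul_smul, ← pow_add, ← pow_succ, ← pow_add,
    show Nat.count (fun j => ¬ inv j) k + 1 + Nat.count inv k = k + 1 by omega,
    show Nat.count (fun j => ¬ inv j) k + Nat.count inv k = k by omega] at hl
  rw [Finset.sum_range_succ, Finset.sum_range_succ, hl, ← hb]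
  abel

theorem X_pow_smul_eq_zero {c : ℕ} {v : Fin n → ℂ[X]} (h : (X : ℂ[X]) ^ c • v = 0) : v = 0 :=
  (smul_eq_zero.1 h).resolve_left (pow_ne_zero _ X_ne_zero)

theorem Sys.zero (hm : 2 ≤ m) (h : Sys A inv m a b z) (h0 : a 0 = 0) (k : ℕ) (hk : k < m) :
    z k = 0 := by
  have hz : ∀ k < m, a k = 0 := fun k hk => by rw [h.a_eq k hk, h0, smul_zero]
  have hb : ∀ k < m, b k = 0 := fun k hk => by
    have := h.b_eq k hk
    simp only [h0, act_zero, smul_zero, Finset.sum_const_zero, add_zero] at this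
    exact X_pow_smul_eq_zero this
  by_cases hk' : k + 1 < m
  · by_cases hi : inv k
    · rw [← (h.inv k hk' hi).1, hz k hk]
    · rw [← (h.cons k hk' hi).2.1, hb _ hk']
  · obtain rfl : k = m - 1 := by omega
    rw [← h.last, hz _ hk]

theorem natDegree_act_le {α β : Type*} [Fintype β] (M : Matrix α β ℂ) (x : β → ℂ[X]) (i : α) :
    (act M x i).natDegree ≤ vecDeg x := by
  simp only [act, Matrix.mulVec, dotProduct, Matrix.map_apply]
  refine Polynomial.natDegree_sum_le_of_forall_le _ _ fun j _ => ?_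
  refine (Polynomial.natDegree_C_mul_le _ _).trans ?_
  exact Finset.le_sup (f := fun i => (x i).natDegree) (Finset.mem_univ j)

theorem natDegree_le_vecDeg {β : Type*} [Fintype β] (x : β → ℂ[X]) (i : β) :
    (x i).natDegree ≤ vecDeg x :=
  Finset.le_sup (f := fun i => (x i).natDegree) (Finset.mem_univ i)

theorem Sys.deg_le (hm : 2 ≤ m) (h : Sys A inv m a b z) (k : ℕ) (hk : k < m) (i : Fin n) :
    (z k i).natDegree ≤ vecDeg (a 0) + Nat.count inv (m - 1) := by
  have ha : ∀ k < m, (a k i).natDegree ≤ vecDeg (a 0) + Nat.count inv (m - 1) := fun k hk => by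
    rw [h.a_eq k hk]
    simp only [Pi.smul_apply, smul_eq_mul]
    refine natDegree_mul_le.trans ?_
    rw [natDegree_X_pow, add_comm]
    exact add_le_add (natDegree_le_vecDeg _ _) (Nat.count_monotone _ (by omega))
  have hb : ∀ k < m, (b k i).natDegree ≤ vecDeg (a 0) + Nat.count inv (m - 1) := fun k hk => by
    have := congrFun (h.b_eq k hk) i
    simp only [Pi.add_apply, Pi.smul_apply, smul_eq_mul, Finset.sum_apply, Pi.zero_apply] at this
    rw [add_eq_zero_iff_eq_neg] at this
    by_cases h0 : b k i = 0
    · rw [h0]; simp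
    have h1 : (X ^ Nat.count (fun j => ¬ inv j) k * b k i : ℂ[X]).natDegree =
        Nat.count (fun j => ¬ inv j) k + (b k i).natDegree := by
      rw [natDegree_mul (pow_ne_zero _ X_ne_zero) h0, natDegree_X_pow]
    rw [this, natDegree_neg] at h1
    have h2 : (∑ j ∈ Finset.range k, (X : ℂ[X]) ^ j * act (A j) (a 0) i).natDegree ≤
        k + vecDeg (a 0) := by
      refine Polynomial.natDegree_sum_le_of_forall_le _ _ fun j hj => ?_
      refine natDegree_mul_le.trans ?_
      rw [natDegree_X_pow]
      exact add_le_add (Finset.mem_range.1 hj).le (natDegree_act_le _ _ _)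
    have h3 := count_add inv k
    have h4 : Nat.count inv k ≤ Nat.count inv (m - 1) := Nat.count_monotone _ (by omega)
    omega
  by_cases hk' : k + 1 < m
  · by_cases hi : inv k
    · rw [← (h.inv k hk' hi).1]; exact ha k hk
    · rw [← (h.cons k hk' hi).2.1]; exact hb _ hk'
  · obtain rfl : k = m - 1 := by omega
    rw [← h.last]; exact ha _ hk

/-- Horner shifts. -/
noncomputable def H (A : ℕ → Matrix (Fin n) (Fin n) ℂ) (m : ℕ) (v : Fin n → ℂ[X]) (k : ℕ) :
    Fin n → ℂ[X] := ∑ j ∈ Finset.range (m + 1 - k), (X : ℂ[X]) ^ j • act (A (k + j)) v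

theorem H_succ (v : Fin n → ℂ[X]) (k : ℕ) (hk : k < m + 1) :
    H A m v k = act (A k) v + (X : ℂ[X]) • H A m v (k + 1) := by
  unfold H
  rw [show m + 1 - k = (m + 1 - (k + 1)) + 1 by omega, Finset.sum_range_succ', Finset.smul_sum,
    add_comm]
  congr 1
  · simp
  · refine Finset.sum_congr rfl fun j _ => ?_
    rw [smul_smul, pow_succ', show k + (j + 1) = k + 1 + j by omega]

variable (A inv) in
/-- The canonical solution of the recursion. -/
theorem sys_exists (hm : 2 ≤ m) (v : Fin n → ℂ[X]) (hv : polyP m n A *ᵥ v = 0) :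
    ∃ a b z, Sys A inv m a b z ∧ a 0 = v := by
  refine ⟨fun k => (X : ℂ[X]) ^ Nat.count inv k • v,
    fun k => (X : ℂ[X]) ^ Nat.count inv k • H A m v k,
    fun k => if k + 1 < m ∧ ¬ inv k then (X : ℂ[X]) ^ Nat.count inv k • H A m v (k + 1)
      else (X : ℂ[X]) ^ Nat.count inv k • v, ⟨?_, ?_, ?_, ?_, ?_⟩, by simp⟩
  · rw [polyP_mulVec] at hv
    simpa [H] using hv
  · intro k hk hi
    simp only [Nat.count_succ, hi, hk, if_false, add_zero, not_false_eq_true, and_self, if_true,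
      true_and]
    rw [H_succ v k (by omega), act_neg_left, act_smul, smul_add, smul_smul, smul_smul, mul_comm]
    abel
  · intro k hk hi
    simp only [Nat.count_succ, hi, hk, if_true, not_true_eq_false, and_false, if_false,
      true_and]
    rw [H_succ v k (by omega), act_neg_left, act_smul, smul_add, smul_smul, smul_smul, pow_succ']
    refine ⟨?_, rfl⟩
    rw [mul_comm X]; abel
  · rw [if_neg (by omega)]
  · rw [if_neg (by omega), H_succ v (m - 1) (by omega), act_neg_left, act_smul, act_smul, smul_add,
      Nat.sub_add_cancel (by omega : 1 ≤ m), H_succ v m (by omega)]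
    simp only [H, Nat.sub_self, Finset.range_zero, Finset.sum_empty, smul_zero, add_zero]
    rw [smul_smul, smul_smul, mul_comm]
    abel

end recursion

/-! ### Null vectors of Fiedler pencils -/

theorem blk_smul (c : ℂ[X]) (x : Fin m × Fin n → ℂ[X]) (k : ℕ) (hk : k < m) :
    blk (c • x) k = c • blk x k := by
  ext1 i
  have : m - 1 - k < m := by omega
  simp [blk, this]

theorem exists_blk (z : ℕ → Fin n → ℂ[X]) :
    ∃ x : Fin m × Fin n → ℂ[X], ∀ k < m, blk x k = z k := by
  refine ⟨fun p => z (m - 1 - p.1) p.2, fun k hk => ?_⟩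
  ext1 i
  have h1 : m - 1 - k < m := by omega
  have h2 : m - 1 - (m - 1 - k) = k := by omega
  simp [blk, h1, h2]

theorem wires (hm : 2 ≤ m) (A : ℕ → Matrix (Fin n) (Fin n) ℂ) (L : List ℕ)
    (hL : L.Perm (List.range m)) (z : Fin m × Fin n → ℂ[X]) :
    (∀ k, k + 1 < m → ¬ Inv L k → aV A L z k = aV A L z (k + 1) ∧ bV A L z (k + 1) = blk z k ∧
      blk (act (pp m n (fp A L)) z) k = act (-A k) (aV A L z k) + bV A L z k) ∧
    (∀ k, k + 1 < m → Inv L k → aV A L z k = blk z k ∧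
      bV A L z (k + 1) = act (-A k) (aV A L z k) + bV A L z k ∧
      blk (act (pp m n (fp A L)) z) k = aV A L z (k + 1)) ∧
    aV A L z (m - 1) = blk z (m - 1) ∧
    blk (act (pp m n (fp A L)) z) (m - 1) =
      act (-A (m - 1)) (aV A L z (m - 1)) + bV A L z (m - 1) := by
  have hn : L.Nodup := hL.nodup_iff.2 List.nodup_range
  have hmem : ∀ j, j ∈ L ↔ j < m := fun j => by rw [hL.mem_iff, List.mem_range]
  have hlt : ∀ j ∈ L, j < m := fun j hj => (hmem j).1 hj
  refine ⟨fun k hk hi => ?_, fun k hk hi => ?_,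
    wire_last hm A L hlt hn ((hmem _).2 (by omega)) z⟩
  · rcases split_cases L hn k ((hmem _).2 (by omega)) ((hmem _).2 hk) with ⟨_, p, q, r, rfl⟩ | ⟨h, _⟩
    · exact wire_cons hm A p q r k hk hlt hn z
    · exact absurd h hi
  · rcases split_cases L hn k ((hmem _).2 (by omega)) ((hmem _).2 hk) with ⟨h, _⟩ | ⟨_, p, q, r, rfl⟩
    · exact absurd hi h
    · exact wire_inv hm A p q r k hk hlt hn z

theorem blk_negm (hm : 2 ≤ m) (B : Matrix (Fin n) (Fin n) ℂ) (z : Fin m × Fin n → ℂ[X]) (k : ℕ)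
    (hk : k + 1 < m) : blk (act (elemMat m n (.neg m) B) z) k = blk z k :=
  gate_other (m := m) (.neg m) le_rfl _ _ _ (by omega)
    (by show m ≠ k; omega) (by show m ≠ k + 1; omega)

theorem fiedler_sys (hm : 2 ≤ m) (A : ℕ → Matrix (Fin n) (Fin n) ℂ) (L : List ℕ)
    (hL : L.Perm (List.range m)) (z : Fin m × Fin n → ℂ[X])
    (hF : (X : ℂ[X]) • act (elemMat m n (.neg m) (A m)) z = act (pp m n (fp A L)) z) :
    Sys A (Inv L) m (aV A L z) (bV A L z) (blk z) := by
  obtain ⟨h1, h2, h3, h4⟩ := wires hm A L hL z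
  have e : ∀ k, k + 1 < m → blk (act (pp m n (fp A L)) z) k = (X : ℂ[X]) • blk z k := by
    intro k hk
    rw [← hF, blk_smul _ _ _ (by omega), blk_negm hm _ _ _ hk]
  refine ⟨by simp [bV], fun k hk hi => ?_, fun k hk hi => ?_, h3, ?_⟩
  · rw [← e k hk]; exact h1 k hk hi
  · rw [← e k hk]; exact h2 k hk hi
  · rw [← h4, ← hF, blk_smul _ _ _ (by omega), gate_m (m := m) (.neg m) rfl hm]

theorem fiedler_exists (hm : 2 ≤ m) (A : ℕ → Matrix (Fin n) (Fin n) ℂ) (L : List ℕ)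
    (hL : L.Perm (List.range m)) (v : Fin n → ℂ[X]) (hv : polyP m n A *ᵥ v = 0) :
    ∃ z : Fin m × Fin n → ℂ[X],
      (X : ℂ[X]) • act (elemMat m n (.neg m) (A m)) z = act (pp m n (fp A L)) z ∧
      aV A L z 0 = v := by
  obtain ⟨a, b, z', hs, ha⟩ := sys_exists A (Inv L) hm v hv
  obtain ⟨z, hz⟩ := exists_blk (m := m) z'
  obtain ⟨h1, h2, h3, h4⟩ := wires hm A L hL z
  have hA : ∀ d, d < m → aV A L z (m - 1 - d) = a (m - 1 - d) := by
    intro d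
    induction d with
    | zero => intro _; rw [Nat.sub_zero, h3, hz _ (by omega), hs.last]
    | succ d ih =>
      intro hd
      have ih := ih (by omega)
      rw [show m - 1 - d = m - 1 - (d + 1) + 1 by omega] at ih
      generalize hk : m - 1 - (d + 1) = k at *
      by_cases hi : Inv L k
      · rw [(h2 k (by omega) hi).1, hz _ (by omega), (hs.inv k (by omega) hi).1]
      · rw [(h1 k (by omega) hi).1, ih, (hs.cons k (by omega) hi).1]
  have hA' : ∀ k < m, aV A L z k = a k := fun k hk => by
    have := hA (m - 1 - k) (by omega)
    rwa [show m - 1 - (m - 1 - k) = k by omega] at this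
  have hB : ∀ k < m, bV A L z k = b k := by
    intro k
    induction k with
    | zero => intro _; rw [hs.b0]; simp [bV]
    | succ k ih =>
      intro hk
      by_cases hi : Inv L k
      · rw [(h2 k hk hi).2.1, (hs.inv k hk hi).2.1, ih (by omega), hA' k (by omega)]
      · rw [(h1 k hk hi).2.1, (hs.cons k hk hi).2.1, hz k (by omega)]
  refine ⟨z, ?_, by rw [hA' 0 (by omega), ha]⟩
  refine blk_ext fun k hk => ?_
  rw [blk_smul _ _ _ hk]
  by_cases hk' : k + 1 < m
  · rw [blk_negm hm _ _ _ hk', hz k hk]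
    by_cases hi : Inv L k
    · rw [(h2 k hk' hi).2.2, (hs.inv k hk' hi).2.2, hA' _ hk']
    · rw [(h1 k hk' hi).2.2, (hs.cons k hk' hi).2.2, hA' _ hk, hB _ hk]
  · obtain rfl : k = m - 1 := by omega
    rw [gate_m (m := m) (.neg m) rfl hm, hz _ hk, hs.last', h4, hA' _ hk, hB _ hk]

open Classical in
theorem fiedler_deg (hm : 2 ≤ m) (A : ℕ → Matrix (Fin n) (Fin n) ℂ) (L : List ℕ)
    (hL : L.Perm (List.range m)) (z : Fin m × Fin n → ℂ[X])
    (hF : (X : ℂ[X]) • act (elemMat m n (.neg m) (A m)) z = act (pp m n (fp A L)) z)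
    (hz : z ≠ 0) :
    vecDeg z = vecDeg (aV A L z 0) + Nat.count (Inv L) (m - 1) := by
  have hs := fiedler_sys hm A L hL z hF
  have ha0 : aV A L z 0 ≠ 0 := fun h => hz (blk_ext fun k hk => by
    rw [hs.zero hm h k hk]; ext1 i; simp [blk])
  apply le_antisymm
  · refine Finset.sup_le fun p _ => ?_
    have := hs.deg_le hm (m - 1 - p.1) (by omega) p.2
    have e : m - 1 - (m - 1 - (p.1 : ℕ)) = p.1 := by omega
    simpa [blk, e] using this
  · have key : ∀ i, aV A L z 0 i ≠ 0 →
        (aV A L z 0 i).natDegree + Nat.count (Inv L) (m - 1) ≤ vecDeg z := by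
      intro i hi
      have h1 := congrFun (hs.a_eq (m - 1) (by omega)) i
      rw [hs.last] at h1
      simp only [Pi.smul_apply, smul_eq_mul] at h1
      have h2 := congrArg natDegree h1
      rw [natDegree_mul (pow_ne_zero _ X_ne_zero) hi, natDegree_X_pow] at h2
      rw [add_comm, ← h2]
      have h3 : m - 1 - (m - 1) < m := by omega
      simp only [blk, h3, dif_pos]
      exact natDegree_le_vecDeg _ _
    obtain ⟨i0, hi0⟩ := Function.ne_iff.1 ha0
    obtain ⟨i, _, hi⟩ := Finset.exists_mem_eq_sup (Finset.univ : Finset (Fin n)) ⟨i0, by simp⟩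
      (fun i => (aV A L z 0 i).natDegree)
    by_cases h : aV A L z 0 i = 0
    · have : vecDeg (aV A L z 0) = 0 := by rw [vecDeg, hi, h, natDegree_zero]
      rw [this]
      exact (Nat.add_le_add_right (Nat.zero_le _) _).trans (key i0 hi0)
    · rw [vecDeg, hi]; exact key i h

/-! ### Transfer of minimal bases -/

theorem vecDeg_act_le {α β : Type*} [Fintype α] [Fintype β] (M : Matrix α β ℂ) (x : β → ℂ[X]) :
    vecDeg (act M x) ≤ vecDeg x := Finset.sup_le fun i _ => natDegree_act_le M x i

theorem vecDeg_act_unit {α : Type*} [Fintype α] [DecidableEq α] (M : Matrix α α ℂ)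
    (h : IsUnit M) (x : α → ℂ[X]) : vecDeg (act M x) = vecDeg x := by
  obtain ⟨u, rfl⟩ := h
  refine le_antisymm (vecDeg_act_le _ _) ?_
  calc vecDeg x = vecDeg (act (u⁻¹).1 (act u.1 x)) := by rw [← act_mul, Units.inv_mul, act_one]
    _ ≤ _ := vecDeg_act_le _ _

theorem toRF_inj : Function.Injective toRF := RatFunc.algebraMap_injective ℂ

theorem map_mulVec_ratVec {α β : Type*} [Fintype β] (M : Matrix α β ℂ[X]) (x : β → ℂ[X]) :
    (M.map toRF) *ᵥ ratVec x = ratVec (M *ᵥ x) := by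
  ext1 i
  simp [Matrix.mulVec, dotProduct, ratVec, map_sum]

theorem ratVec_inj {β : Type*} : Function.Injective (ratVec (β := β)) := by
  intro x y h
  ext1 i
  exact toRF_inj (congrFun h i)

theorem ratVec_zero {β : Type*} : ratVec (0 : β → ℂ[X]) = 0 := by
  ext1 i; simp [ratVec]

theorem ratVec_smul {β : Type*} (c : ℂ[X]) (x : β → ℂ[X]) :
    ratVec (c • x) = toRF c • ratVec x := by
  ext1 i; simp [ratVec]

open Classical in
theorem clear_denom {β : Type*} [Fintype β] (x : β → RatFunc ℂ) :
    ∃ (d : ℂ[X]) (y : β → ℂ[X]), d ≠ 0 ∧ toRF d • x = ratVec y := by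
  obtain ⟨d, hd⟩ := IsLocalization.exist_integer_multiples_of_finset (nonZeroDivisors ℂ[X])
    (Finset.univ.image x)
  have : ∀ i, ∃ y : ℂ[X], toRF y = toRF d.1 * x i := by
    intro i
    obtain ⟨y, hy⟩ := hd (x i) (by simp)
    refine ⟨y, ?_⟩
    rw [show toRF y = algebraMap ℂ[X] (RatFunc ℂ) y from rfl, hy, Algebra.smul_def]; rfl
  choose y hy using this
  refine ⟨d.1, y, nonZeroDivisors.ne_zero d.2, ?_⟩
  ext1 i
  simp [ratVec, hy]

/-- Data for transferring kernels. -/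
structure Transfer {α β α' β' : Type*} [Fintype β] [Fintype β'] (M : Matrix α β ℂ[X])
    (N : Matrix α' β' ℂ[X]) (S : Matrix β' β ℂ[X]) (d : ℕ) : Prop where
  map : ∀ x, M *ᵥ x = 0 → N *ᵥ (S *ᵥ x) = 0
  inj : ∀ x, M *ᵥ x = 0 → S *ᵥ x = 0 → x = 0
  deg : ∀ x, M *ᵥ x = 0 → x ≠ 0 → vecDeg x = vecDeg (S *ᵥ x) + d
  surj : ∀ v, N *ᵥ v = 0 → ∃ x, M *ᵥ x = 0 ∧ S *ᵥ x = v

section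
variable {α β α' β' : Type*} [Fintype β] [Fintype β'] {M : Matrix α β ℂ[X]}
    {N : Matrix α' β' ℂ[X]} {S : Matrix β' β ℂ[X]} {d : ℕ}

theorem toRF_ne {c : ℂ[X]} (h : c ≠ 0) : toRF c ≠ 0 := fun e =>
  h (toRF_inj (e.trans (map_zero _).symm))

theorem Transfer.mapRF (T : Transfer M N S d) (x : β → RatFunc ℂ) (hx : M.map toRF *ᵥ x = 0) :
    N.map toRF *ᵥ (S.map toRF *ᵥ x) = 0 := by
  obtain ⟨c, y, hc, hy⟩ := clear_denom x
  have h1 : M *ᵥ y = 0 := ratVec_inj (by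
    rw [← map_mulVec_ratVec, ← hy, Matrix.mulVec_smul, hx, smul_zero, ratVec_zero])
  have h2 := T.map y h1
  have h3 : toRF c • (N.map toRF *ᵥ (S.map toRF *ᵥ x)) = 0 := by
    rw [← Matrix.mulVec_smul, ← Matrix.mulVec_smul, hy, map_mulVec_ratVec, map_mulVec_ratVec, h2,
      ratVec_zero]
  exact (smul_eq_zero.1 h3).resolve_left (toRF_ne hc)

theorem Transfer.injRF (T : Transfer M N S d) (x : β → RatFunc ℂ) (hx : M.map toRF *ᵥ x = 0)
    (hs : S.map toRF *ᵥ x = 0) : x = 0 := by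
  obtain ⟨c, y, hc, hy⟩ := clear_denom x
  have h1 : M *ᵥ y = 0 := ratVec_inj (by
    rw [← map_mulVec_ratVec, ← hy, Matrix.mulVec_smul, hx, smul_zero, ratVec_zero])
  have h2 : S *ᵥ y = 0 := ratVec_inj (by
    rw [← map_mulVec_ratVec, ← hy, Matrix.mulVec_smul, hs, smul_zero, ratVec_zero])
  have h3 := T.inj y h1 h2
  rw [h3, ratVec_zero] at hy
  exact (smul_eq_zero.1 hy).resolve_left (toRF_ne hc)

theorem Transfer.surjRF (T : Transfer M N S d) (v : β' → RatFunc ℂ) (hv : N.map toRF *ᵥ v = 0) :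
    ∃ x, M.map toRF *ᵥ x = 0 ∧ S.map toRF *ᵥ x = v := by
  obtain ⟨c, y, hc, hy⟩ := clear_denom v
  have h1 : N *ᵥ y = 0 := ratVec_inj (by
    rw [← map_mulVec_ratVec, ← hy, Matrix.mulVec_smul, hv, smul_zero, ratVec_zero])
  obtain ⟨x, hx, hx'⟩ := T.surj y h1
  refine ⟨(toRF c)⁻¹ • ratVec x, ?_, ?_⟩
  · rw [Matrix.mulVec_smul, map_mulVec_ratVec, hx, ratVec_zero, smul_zero]
  · rw [Matrix.mulVec_smul, map_mulVec_ratVec, hx', ← hy, smul_smul,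
      inv_mul_cancel₀ (toRF_ne hc), one_smul]

theorem Transfer.basis_iff (T : Transfer M N S d) {p : ℕ} (v : Fin p → β → ℂ[X])
    (hv : ∀ j, M *ᵥ v j = 0) :
    IsRightPolyBasis (M.map toRF) v ↔ IsRightPolyBasis (N.map toRF) (fun j => S *ᵥ v j) := by
  have hvR : ∀ j, M.map toRF *ᵥ ratVec (v j) = 0 := fun j => by
    rw [map_mulVec_ratVec, hv, ratVec_zero]
  have hcomb : ∀ c : Fin p → RatFunc ℂ, M.map toRF *ᵥ (∑ j, c j • ratVec (v j)) = 0 := by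
    intro c
    rw [← Matrix.mulVecLin_apply, map_sum]
    refine Finset.sum_eq_zero fun j _ => ?_
    rw [map_smul, Matrix.mulVecLin_apply, hvR, smul_zero]
  have hS : ∀ c : Fin p → RatFunc ℂ, S.map toRF *ᵥ (∑ j, c j • ratVec (v j)) =
      ∑ j, c j • ratVec (S *ᵥ v j) := by
    intro c
    rw [← Matrix.mulVecLin_apply, map_sum]
    refine Finset.sum_congr rfl fun j _ => ?_
    rw [map_smul, Matrix.mulVecLin_apply, map_mulVec_ratVec]
  constructor
  · rintro ⟨-, h2, h3⟩
    refine ⟨fun j => ?_, ?_, fun y hy => ?_⟩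
    · rw [map_mulVec_ratVec, T.map _ (hv j), ratVec_zero]
    · rw [Fintype.linearIndependent_iff] at h2 ⊢
      intro c hc
      rw [← hS] at hc
      exact h2 c (T.injRF _ (hcomb c) hc)
    · obtain ⟨x, hx, rfl⟩ := T.surjRF y hy
      obtain ⟨c, rfl⟩ := (Submodule.mem_span_range_iff_exists_fun _).1 (h3 x hx)
      exact (Submodule.mem_span_range_iff_exists_fun _).2 ⟨c, (hS c).symm⟩
  · rintro ⟨-, h2, h3⟩
    refine ⟨hvR, ?_, fun x hx => ?_⟩
    · rw [Fintype.linearIndependent_iff] at h2 ⊢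
      intro c hc
      refine h2 c ?_
      rw [← hS, hc, Matrix.mulVec_zero]
    · obtain ⟨c, hc⟩ := (Submodule.mem_span_range_iff_exists_fun _).1 (h3 _ (T.mapRF x hx))
      refine (Submodule.mem_span_range_iff_exists_fun _).2 ⟨c, ?_⟩
      rw [← sub_eq_zero]
      refine T.injRF _ ?_ ?_
      · rw [Matrix.mulVec_sub, hcomb, hx, sub_zero]
      · rw [Matrix.mulVec_sub, hS, hc, sub_self]

theorem polyBasis_card {p q : ℕ} {R : Matrix α β (RatFunc ℂ)} {v : Fin p → β → ℂ[X]}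
    {w : Fin q → β → ℂ[X]} (hv : IsRightPolyBasis R v) (hw : IsRightPolyBasis R w) : p = q := by
  have e : Submodule.span (RatFunc ℂ) (Set.range fun j => ratVec (v j)) =
      Submodule.span (RatFunc ℂ) (Set.range fun j => ratVec (w j)) := by
    have key : ∀ {p : ℕ} {v : Fin p → β → ℂ[X]}, IsRightPolyBasis R v →
        Submodule.span (RatFunc ℂ) (Set.range fun j => ratVec (v j)) =
        LinearMap.ker (Matrix.mulVecLin R) := by
      intro p v hv
      refine le_antisymm ?_ fun x hx => hv.2.2 x (by simpa using hx)
      rw [Submodule.span_le]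
      rintro _ ⟨j, rfl⟩
      simpa using hv.1 j
    rw [key hv, key hw]
  have h1 := finrank_span_eq_card hv.2.1
  have h2 := finrank_span_eq_card hw.2.1
  rw [e, h2] at h1
  simpa using h1.symm

theorem Transfer.vecDeg_eq (T : Transfer M N S d) {p : ℕ} {v : Fin p → β → ℂ[X]}
    (hv : IsRightPolyBasis (M.map toRF) v) (j : Fin p) :
    vecDeg (v j) = vecDeg (S *ᵥ v j) + d := by
  refine T.deg _ (ratVec_inj ?_) fun h => hv.2.1.ne_zero j (by simp only [h, ratVec_zero])
  rw [← map_mulVec_ratVec, hv.1 j, ratVec_zero]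

theorem Transfer.minimal (T : Transfer M N S d) {p : ℕ} {v : Fin p → β → ℂ[X]}
    (hv : IsRightMinimalBasis (M.map toRF) v) :
    IsRightMinimalBasis (N.map toRF) (fun j => S *ᵥ v j) := by
  have hker : ∀ {β : Type _} {α : Type _} [Fintype β] {M : Matrix α β ℂ[X]} {p : ℕ}
      {v : Fin p → β → ℂ[X]}, IsRightPolyBasis (M.map toRF) v → ∀ j, M *ᵥ v j = 0 :=
    fun hv j => ratVec_inj (by rw [← map_mulVec_ratVec, hv.1 j, ratVec_zero])
  refine ⟨(T.basis_iff v (hker hv.1)).1 hv.1, fun q w hw => ?_⟩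
  have : ∀ j, ∃ x, M *ᵥ x = 0 ∧ S *ᵥ x = w j := fun j => T.surj _ (ratVec_inj (by
    rw [← map_mulVec_ratVec, hw.1 j, ratVec_zero]))
  choose w' hw1 hw2 using this
  have hw' : IsRightPolyBasis (M.map toRF) w' := (T.basis_iff w' hw1).2 (by simpa [hw2] using hw)
  have hpq := polyBasis_card hv.1 hw'
  have h1 := hv.2 q w' hw'
  simp only [T.vecDeg_eq hv.1, T.vecDeg_eq hw', Finset.sum_add_distrib, Finset.sum_const,
    Finset.card_univ, Fintype.card_fin, hw2, hpq] at h1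
  exact Nat.le_of_add_le_add_right h1

theorem Transfer.minBasisMat (T : Transfer M N S d) {p : ℕ} {Z : Matrix β (Fin p) ℂ[X]}
    (hZ : IsRightMinBasisMat (M.map toRF) Z) : IsRightMinBasisMat (N.map toRF) (S * Z) := by
  have h1 := T.minimal hZ.1
  refine ⟨h1, fun i j hij => ?_⟩
  have h2 := hZ.2 hij
  simp only [T.vecDeg_eq hZ.1.1] at h2
  have h3 := Nat.le_of_add_le_add_right h2
  exact h3

theorem Transfer.minIndices (T : Transfer M N S d) {p : ℕ} {ε : Fin p → ℤ}
    (h : RightMinIndices (M.map toRF) ε) :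
    RightMinIndices (N.map toRF) (fun j => ε j - (d : ℤ)) := by
  obtain ⟨v, hv, hm, he⟩ := h
  refine ⟨fun j => S *ᵥ v j, T.minimal hv, fun i j hij => ?_, fun j => ?_⟩
  · have h2 := hm hij
    simp only [T.vecDeg_eq hv.1] at h2
    exact Nat.le_of_add_le_add_right h2
  · have := T.vecDeg_eq hv.1 j
    have h2 := he j
    show (vecDeg (S *ᵥ v j) : ℤ) = ε j - (d : ℤ)
    omega

end

/-! ### Reduction of an EGFP to a Fiedler pencil -/

theorem prodAssign_eq (t : List SIdx) (Xs : List (Matrix (Fin n) (Fin n) ℂ)) :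
    prodAssign m n t Xs = pp m n (t.zip Xs) := rfl

/-- Fiedler pairs. -/
noncomputable def fl (m : ℕ) (A : ℕ → Matrix (Fin n) (Fin n) ℂ) (t : List SIdx) :
    List (SIdx × Matrix (Fin n) (Fin n) ℂ) := t.map fun k => (k, fiedlerX m A k)

theorem prodFiedler_eq (A : ℕ → Matrix (Fin n) (Fin n) ℂ) (t : List SIdx) :
    prodFiedler m n A t = pp m n (fl m A t) := by
  simp [prodFiedler, pp, fl, Function.comp_def]

theorem fl_append (A : ℕ → Matrix (Fin n) (Fin n) ℂ) (t t' : List SIdx) :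
    fl m A (t ++ t') = fl m A t ++ fl m A t' := by simp [fl]

theorem fl_pos (A : ℕ → Matrix (Fin n) (Fin n) ℂ) (t : List SIdx)
    (h : ∀ k ∈ t, k.isNeg = false ∧ k.val < m) : fl m A t = fp A (t.map SIdx.val) := by
  unfold fl fp
  rw [List.map_map]
  refine List.map_congr_left fun k hk => ?_
  obtain ⟨h1, h2⟩ := h k hk
  cases k with
  | neg j => simp [SIdx.isNeg] at h1
  | pos j =>
    simp only [SIdx.val] at h2
    simp [fiedlerX, SIdx.val, h2.ne]

theorem fl_neg_inv (A : ℕ → Matrix (Fin n) (Fin n) ℂ) (t : List SIdx)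
    (h : ∀ k ∈ t, k.isNeg = true ∧ 1 ≤ k.val ∧ k.val < m) :
    pp m n (fl m A t) * pp m n (fp A (t.reverse.map SIdx.val)) = 1 := by
  induction t with
  | nil => simp [fl, fp, pp]
  | cons k t ih =>
    have ih := ih fun j hj => h j (by simp [hj])
    obtain ⟨h1, h2, h3⟩ := h k (by simp)
    cases k with
    | pos j => simp [SIdx.isNeg] at h1
    | neg j =>
      simp only [SIdx.val] at h2 h3
      obtain ⟨j, rfl⟩ : ∃ i, j = i + 1 := ⟨j - 1, by omega⟩
      have e1 : fl m A (.neg (j + 1) :: t) = (.neg (j + 1), A (j + 1)) :: fl m A t := by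
        simp [fl, fiedlerX]
      rw [e1, List.reverse_cons, List.map_append, fp_append, pp_append, pp_cons, mul_assoc,
        ← mul_assoc (pp m n (fl m A t)), ih, one_mul]
      simp only [List.map_cons, List.map_nil, fp_cons, pp_cons, SIdx.val]
      have e2 : pp m n (fp A ([] : List ℕ)) = 1 := rfl
      rw [e2, mul_one]
      exact neg_pos j h3 _

theorem pencil_mulVec {N : Type*} [Fintype N] (M1 M0 : Matrix N N ℂ) (x : N → ℂ[X]) :
    pencilPoly M1 M0 *ᵥ x = (X : ℂ[X]) • act M1 x - act M0 x := by
  ext1 i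
  simp only [Matrix.mulVec, dotProduct, pencilPoly, act, Pi.sub_apply, Pi.smul_apply, smul_eq_mul,
    Matrix.map_apply, sub_mul, Finset.sum_sub_distrib, Finset.mul_sum]
  congr 1
  refine Finset.sum_congr rfl fun j _ => ?_
  ring

theorem rowSel_mulVec (c : ℕ) (hc : c < m) (j : ℤ) (hj : j = (m : ℤ) - c)
    (x : Fin m × Fin n → ℂ[X]) :
    (rowSel m n j).map Polynomial.C *ᵥ x = blk x c := by
  ext1 i
  have h : m - 1 - c < m := by omega
  simp only [Matrix.mulVec, dotProduct, Matrix.map_apply, blk, h, dif_pos]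
  rw [Finset.sum_eq_single ((⟨m - 1 - c, h⟩, i) : Fin m × Fin n)]
  · have : ((m - 1 - c : ℕ) : ℤ) + 1 = j := by omega
    simp [rowSel, this]
  · rintro ⟨q, k⟩ _ hq
    have : ¬ (((q : ℕ) : ℤ) + 1 = j ∧ i = k) := by
      rintro ⟨h1, rfl⟩
      apply hq
      ext
      · simp only []; omega
      · rfl
    simp [rowSel, this]
  · simp

theorem zero_mem_sig (E : EGFPData m n) (hsing : (polyP m n E.A).det = 0) :
    SIdx.neg 0 ∉ E.tau := by
  intro h
  have hu := (Matrix.isUnit_iff_isUnit_det _).1 (E.hA0 h)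
  have h1 : (polyP m n E.A).map (Polynomial.evalRingHom (0 : ℂ)) = E.A 0 := by
    ext p q
    simp only [polyP, Matrix.map_apply, coe_evalRingHom, eval_finsetSum, eval_mul, eval_C, eval_pow,
      eval_X]
    rw [Finset.sum_eq_single 0]
    · simp
    · intro i _ hi; simp [hi]
    · simp
  have h2 := congrArg (Polynomial.evalRingHom (0 : ℂ)) hsing
  rw [RingHom.map_det, RingHom.mapMatrix_apply, h1, map_zero] at h2
  rw [h2] at hu
  exact not_isUnit_zero hu

section reduction

variable (E : EGFPData m n) (τl τr : List SIdx)

/-- The list `α`, as natural numbers. -/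
def alph : List ℕ := τl.reverse.map SIdx.val ++ E.sig.map SIdx.val ++ τr.reverse.map SIdx.val

variable {τl τr}

theorem nodup_all : (E.sig.map SIdx.val ++ E.tau.map SIdx.val).Nodup :=
  E.hperm.nodup_iff.2 List.nodup_range

theorem disj {k j : SIdx} (hk : k ∈ E.sig) (hj : j ∈ E.tau) : k.val ≠ j.val := by
  have := nodup_all E
  rw [List.nodup_append] at this
  exact this.2.2 _ (List.mem_map_of_mem hk) _ (List.mem_map_of_mem hj)

theorem val_le {k : SIdx} (hk : k ∈ E.sig ∨ k ∈ E.tau) : k.val ≤ m := by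
  have : k.val ∈ List.range (m + 1) := by
    rw [← E.hperm.mem_iff, List.mem_append]
    exact hk.imp List.mem_map_of_mem List.mem_map_of_mem
  rw [List.mem_range] at this; omega

theorem alph_perm (hτ : E.tau = τl ++ SIdx.neg m :: τr) :
    (alph E τl τr).Perm (List.range m) := by
  have h := E.hperm
  rw [hτ, List.range_succ, List.map_append, List.map_cons] at h
  rw [← List.perm_cons m]
  refine List.Perm.trans ?_ (h.trans (List.perm_append_singleton m (List.range m)))
  simp only [alph, SIdx.val]
  rw [List.perm_iff_count]
  intro a
  simp only [List.count_append, List.count_cons, List.map_reverse, List.count_reverse]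
  omega

theorem sig_facts (hτ : E.tau = τl ++ SIdx.neg m :: τr) {k : SIdx} (hk : k ∈ E.sig) :
    k.isNeg = false ∧ k.val < m := by
  refine ⟨E.hsigpos k hk, ?_⟩
  have h1 := val_le E (.inl hk)
  have h2 : k.val ≠ (SIdx.neg m).val := disj E hk (by rw [hτ]; simp)
  simp only [SIdx.val] at h1 h2 ⊢
  omega

theorem tau_facts (hτ : E.tau = τl ++ SIdx.neg m :: τr) (h0 : SIdx.neg 0 ∉ E.tau) {k : SIdx}
    (hk : k ∈ τl ∨ k ∈ τr) : k.isNeg = true ∧ 1 ≤ k.val ∧ k.val < m := by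
  have hkt : k ∈ E.tau := by rw [hτ]; simp; tauto
  have hn := E.htauneg k hkt
  refine ⟨hn, ?_, ?_⟩
  · cases k with
    | pos j => simp [SIdx.isNeg] at hn
    | neg j =>
      cases j with
      | zero => exact absurd hkt h0
      | succ j => simp [SIdx.val]
  · have : k.val ∈ alph E τl τr := by
      simp only [alph, List.mem_append, List.mem_map, List.mem_reverse]
      rcases hk with h | h
      · exact .inl (.inl ⟨k, h, rfl⟩)
      · exact .inr ⟨k, h, rfl⟩
    rwa [(alph_perm E hτ).mem_iff, List.mem_range] at this

theorem isUnit_assign {t : List SIdx} {Xs : List (Matrix (Fin n) (Fin n) ℂ)}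
    (h : NonsingAssign m t Xs) (ht : ∀ k ∈ t, k ∈ E.sig ∨ k ∈ E.tau) :
    IsUnit (prodAssign m n t Xs) := by
  rw [prodAssign_eq]
  refine isUnit_pp E.hm _ fun p hp => ⟨val_le E (ht _ (List.of_mem_zip hp).1), h.2 p hp⟩

theorem isUnit_left : IsUnit E.leftFac :=
  (isUnit_assign E E.hY1 fun k hk => .inr (E.htau1 k hk).1).mul
    (isUnit_assign E E.hX1 fun k hk => .inl (E.hsig1 k hk).1)

theorem isUnit_right : IsUnit E.rightFac :=
  (isUnit_assign E E.hX2 fun k hk => .inl (E.hsig2 k hk).1).mul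
    (isUnit_assign E E.hY2 fun k hk => .inr (E.htau2 k hk).1)

theorem pencil_reduce (hτ : E.tau = τl ++ SIdx.neg m :: τr) (h0 : SIdx.neg 0 ∉ E.tau)
    (x : Fin m × Fin n → ℂ[X]) :
    pencilPoly E.L1 E.L0 *ᵥ x =
      act (E.leftFac * pp m n (fl m E.A τl))
        ((X : ℂ[X]) • act (elemMat m n (.neg m) (E.A m))
            (act (pp m n (fl m E.A τr) * E.rightFac) x) -
          act (pp m n (fp E.A (alph E τl τr))) (act (pp m n (fl m E.A τr) * E.rightFac) x)) := by
  have hm := E.hm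
  have hl := fl_neg_inv E.A τl fun k hk => tau_facts E hτ h0 (.inl hk)
  have hr := fl_neg_inv E.A τr fun k hk => tau_facts E hτ h0 (.inr hk)
  have e1 : prodFiedler m n E.A E.tau =
      pp m n (fl m E.A τl) * (elemMat m n (.neg m) (E.A m) * pp m n (fl m E.A τr)) := by
    rw [prodFiedler_eq, hτ, fl_append, pp_append]
    congr 1
    have : fl m E.A (.neg m :: τr) = (.neg m, E.A m) :: fl m E.A τr := by
      simp [fl, fiedlerX, show m ≠ 0 by omega]
    rw [this, pp_cons]
  have e2 : prodFiedler m n E.A E.sig =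
      pp m n (fl m E.A τl) * (pp m n (fp E.A (alph E τl τr)) * pp m n (fl m E.A τr)) := by
    rw [prodFiedler_eq, fl_pos E.A E.sig fun k hk => sig_facts E hτ hk, alph, fp_append, pp_append,
      fp_append, pp_append, mul_assoc, mul_eq_one_comm.mp hr, mul_one, ← mul_assoc, hl, one_mul]
  rw [pencil_mulVec, act_sub, act_smul]
  simp only [EGFPData.L1, EGFPData.L0, e1, e2, act_mul]

theorem recover (hτ : E.tau = τl ++ SIdx.neg m :: τr) (h0 : SIdx.neg 0 ∉ E.tau) :
    ∃ c : ℕ, c < m ∧ consAt (E.sig ++ E.sig2) (.pos 0) = (c : ℤ) ∧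
      ∀ x : Fin m × Fin n → ℂ[X],
        aV E.A (alph E τl τr) (act (pp m n (fl m E.A τr) * E.rightFac) x) 0 = blk x c := by
  have hm := E.hm
  have h0s : SIdx.pos 0 ∈ E.sig := by
    have : 0 ∈ E.sig.map SIdx.val ++ E.tau.map SIdx.val := by
      rw [E.hperm.mem_iff, List.mem_range]; omega
    simp only [List.mem_append, List.mem_map] at this
    rcases this with ⟨k, hk, hv⟩ | ⟨k, hk, hv⟩
    · have := E.hsigpos k hk
      cases k with
      | neg j => simp [SIdx.isNeg] at this
      | pos j => simp only [SIdx.val] at hv; rwa [hv] at hk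
    · have := E.htauneg k hk
      cases k with
      | pos j => simp [SIdx.isNeg] at this
      | neg j => simp only [SIdx.val] at hv; rw [hv] at hk; exact absurd hk h0
  obtain ⟨s1, s2, hs⟩ := List.append_of_mem h0s
  have hnd := (alph_perm E hτ).nodup_iff.2 List.nodup_range
  have e1 : alph E τl τr = (τl.reverse.map SIdx.val ++ s1.map SIdx.val) ++
      0 :: (s2.map SIdx.val ++ τr.reverse.map SIdx.val) := by
    simp [alph, hs, SIdx.val]
  have hpre : 0 ∉ τl.reverse.map SIdx.val ++ s1.map SIdx.val := by
    rw [e1, List.nodup_append] at hnd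
    exact fun h => hnd.2.2 _ h 0 (by simp) rfl
  have hs1 : SIdx.pos 0 ∉ s1 := fun h => hpre (by
    rw [List.mem_append]; right; exact List.mem_map.2 ⟨_, h, rfl⟩)
  have hlen : E.sig2.length = E.X2.length := E.hX2.1
  have hsip := E.hSIPsig
  rw [hs] at hsip
  have hmem : ∀ k ∈ SIdx.pos 0 :: (s2 ++ E.sig2), k ∈ E.sig := by
    intro k hk
    simp only [List.mem_cons, List.mem_append] at hk
    rcases hk with rfl | hk | hk
    · exact h0s
    · rw [hs]; simp [hk]
    · exact (E.hsig2 k hk).1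
  have hcs : SIdx.pos (scan 0 (s2 ++ E.sig2)) ∈ E.sig := hmem _ (scan_mem _ _)
  have hcm : scan 0 (s2 ++ E.sig2) < m := (sig_facts E hτ hcs).2
  refine ⟨scan 0 (s2 ++ E.sig2), hcm, ?_, fun x => ?_⟩
  · rw [hs, List.append_assoc, List.cons_append, consAt_eq_scan _ _ hs1]
  have hr := fl_neg_inv E.A τr fun k hk => tau_facts E hτ h0 (.inr hk)
  have hfst : (fl m E.A s2 ++ E.sig2.zip E.X2).map Prod.fst = s2 ++ E.sig2 := by
    rw [List.map_append, List.map_fst_zip (by omega)]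
    simp [fl, Function.comp_def]
  unfold aV
  rw [e1, after_split _ _ _ hpre, fp_append, pp_append, act_mul, act_mul,
    ← act_mul (pp m n (fp E.A (τr.reverse.map SIdx.val))), mul_eq_one_comm.mp hr, act_one,
    EGFPData.rightFac, act_mul (prodAssign m n E.sig2 E.X2), prodAssign_eq, prodAssign_eq,
    ← fl_pos E.A s2 fun k hk => sig_facts E hτ (hmem k (by simp [hk])), ← act_mul, ← pp_append,
    scan_blk _ 0 (by omega), hfst]
  · refine pp_untouched _ _ hcm (fun p hp => ?_) x
    have hp1 := (List.of_mem_zip hp).1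
    have hpt := (E.htau2 _ hp1).1
    refine ⟨val_le E (.inr hpt), fun h => disj E hcs hpt (by rw [h]; rfl), fun h => ?_⟩
    -- the successor infix property forces `neg c` into `τ`
    have hneg := E.htauneg _ hpt
    have hpe : p.1 = SIdx.neg (scan 0 (s2 ++ E.sig2) + 1) := by
      cases hp' : p.1 with
      | pos j => rw [hp'] at hneg; simp [SIdx.isNeg] at hneg
      | neg j => rw [hp'] at h; simp only [SIdx.val] at h; rw [h]
    obtain ⟨u1, u2, hu⟩ := List.append_of_mem hpt
    obtain ⟨v1, v2, hv⟩ := List.append_of_mem hp1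
    have := SIP_split E.hSIPtau (p := E.tau1 ++ u1) (q := u2 ++ v1) (r := v2) (a := p.1)
      (by rw [hu, hv]; simp)
    have hin : p.1.succ ∈ E.tau := by
      rw [List.mem_append] at this
      rcases this with h' | h'
      · rw [hu]; simp [h']
      · exact (E.htau2 _ (by rw [hv]; simp [h'])).1
    rw [hpe] at hin
    exact disj E hcs hin rfl
  · intro p hp
    have : p.1 ∈ s2 ++ E.sig2 := by rw [← hfst]; exact List.mem_map_of_mem hp
    have := sig_facts E hτ (hmem p.1 (List.mem_cons_of_mem _ this))
    exact ⟨this.2, this.1⟩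
  · intro p q r a e
    rw [hfst] at e
    refine SIP_split hsip (p := E.sig1 ++ s1 ++ .pos 0 :: p) (r := r) ?_
    simp [e]
  · intro p r e
    rw [hfst] at e
    refine SIP_split hsip (p := E.sig1 ++ s1) (r := r) (a := .pos 0) ?_
    simp [e]

open Classical in
theorem totalInvs_eq (hτ : E.tau = τl ++ SIdx.neg m :: τr) (h0 : SIdx.neg 0 ∉ E.tau) :
    totalInvs m ((τl.reverse.map SIdx.negate) ++ E.sig ++ (τr.reverse.map SIdx.negate)) =
      Nat.count (Inv (alph E τl τr)) (m - 1) := by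
  have e : (τl.reverse.map SIdx.negate) ++ E.sig ++ (τr.reverse.map SIdx.negate) =
      (alph E τl τr).map SIdx.pos := by
    simp only [alph, List.map_append, List.map_map]
    have hneg : ∀ t : List SIdx, (∀ k ∈ t, k.isNeg = true) →
        t.map SIdx.negate = t.map (SIdx.pos ∘ SIdx.val) := fun t ht =>
      List.map_congr_left fun k hk => by
        have := ht k hk
        cases k with
        | pos j => simp [SIdx.isNeg] at this
        | neg j => rfl
    have hpos : E.sig.map (SIdx.pos ∘ SIdx.val) = E.sig := by
      conv_rhs => rw [← List.map_id E.sig]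
      refine List.map_congr_left fun k hk => ?_
      have := E.hsigpos k hk
      cases k with
      | neg j => simp [SIdx.isNeg] at this
      | pos j => rfl
    rw [hpos, hneg, hneg]
    · intro k hk; exact (tau_facts E hτ h0 (.inr (by simpa using hk))).1
    · intro k hk; exact (tau_facts E hτ h0 (.inl (by simpa using hk))).1
  rw [e, totalInvs, Nat.count_eq_card_filter_range]
  congr 1
  refine Finset.filter_congr fun i _ => ?_
  constructor
  · intro h
    have := h.map SIdx.val
    simpa [Inv, Function.comp_def, SIdx.val] using this
  · intro h
    exact h.map SIdx.pos

theorem main_transfer (hsing : (polyP m n E.A).det = 0) (hτ : E.tau = τl ++ SIdx.neg m :: τr) :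
    Transfer (pencilPoly E.L1 E.L0) (polyP m n E.A)
      ((rowSel m n ((m : ℤ) - consAt (E.sig ++ E.sig2) (.pos 0))).map Polynomial.C)
      (totalInvs m ((τl.reverse.map SIdx.negate) ++ E.sig ++ (τr.reverse.map SIdx.negate))) := by
  classical
  have h0 := zero_mem_sig E hsing
  have hm := E.hm
  obtain ⟨c, hc, hcons, hrec⟩ := recover E hτ h0
  have hL := alph_perm E hτ
  have hl := fl_neg_inv E.A τl fun k hk => tau_facts E hτ h0 (.inl hk)
  have hr := fl_neg_inv E.A τr fun k hk => tau_facts E hτ h0 (.inr hk)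
  have hU : IsUnit (E.leftFac * pp m n (fl m E.A τl)) :=
    (isUnit_left E).mul ⟨⟨_, _, hl, mul_eq_one_comm.mp hl⟩, rfl⟩
  have hT : IsUnit (pp m n (fl m E.A τr) * E.rightFac) :=
    IsUnit.mul ⟨⟨_, _, hr, mul_eq_one_comm.mp hr⟩, rfl⟩ (isUnit_right E)
  have hS : ∀ x, (rowSel m n ((m : ℤ) - consAt (E.sig ++ E.sig2) (.pos 0))).map Polynomial.C *ᵥ x
      = aV E.A (alph E τl τr) (act (pp m n (fl m E.A τr) * E.rightFac) x) 0 := fun x => by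
    rw [rowSel_mulVec c hc _ (by rw [hcons]), hrec]
  have hinj : ∀ {M : Matrix (Fin m × Fin n) (Fin m × Fin n) ℂ}, IsUnit M →
      ∀ x, act M x = 0 → x = 0 := by
    rintro _ ⟨u, rfl⟩ x hx
    have := congrArg (act (u⁻¹).1) hx
    rwa [← act_mul, Units.inv_mul, act_one, act_zero] at this
  have hF : ∀ x, pencilPoly E.L1 E.L0 *ᵥ x = 0 ↔
      (X : ℂ[X]) • act (elemMat m n (.neg m) (E.A m))
        (act (pp m n (fl m E.A τr) * E.rightFac) x) =
      act (pp m n (fp E.A (alph E τl τr))) (act (pp m n (fl m E.A τr) * E.rightFac) x) := by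
    intro x
    rw [pencil_reduce E hτ h0 x]
    constructor
    · intro h; exact sub_eq_zero.1 (hinj hU _ h)
    · intro h; rw [h, sub_self, act_zero]
  refine ⟨fun x hx => ?_, fun x hx hsx => ?_, fun x hx hx0 => ?_, fun v hv => ?_⟩
  · rw [hS]
    exact (fiedler_sys hm E.A _ hL _ ((hF x).1 hx)).ker hm
  · rw [hS] at hsx
    refine hinj hT x (blk_ext fun k hk => ?_)
    rw [(fiedler_sys hm E.A _ hL _ ((hF x).1 hx)).zero hm hsx k hk]
    ext1 i; simp [blk]
  · rw [hS, totalInvs_eq E hτ h0, ← vecDeg_act_unit _ hT x]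
    exact fiedler_deg hm E.A _ hL _ ((hF x).1 hx) fun h => hx0 (hinj hT x h)
  · obtain ⟨z, hz1, hz2⟩ := fiedler_exists hm E.A _ hL v hv
    obtain ⟨u, hu⟩ := hT
    have hx : act (pp m n (fl m E.A τr) * E.rightFac) (act (u⁻¹).1 z) = z := by
      rw [← hu, ← act_mul, Units.mul_inv, act_one]
    refine ⟨act (u⁻¹).1 z, ?_, ?_⟩
    · rw [hF, hx]; exact hz1
    · rw [hS, hx, hz2]

end reduction

/-! ### Transposition -/

theorem elemMat_transpose (k : SIdx) (X : Matrix (Fin n) (Fin n) ℂ) :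
    (elemMat m n k X)ᵀ = elemMat m n k Xᵀ := by
  ext ⟨p, i⟩ ⟨q, j⟩
  have e1 : (i = j) = (j = i) := propext eq_comm
  have e2 : (p = q) = (q = p) := propext eq_comm
  simp only [Matrix.transpose_apply, elemMat, Prod.mk.injEq, e1, e2]
  by_cases h0 : k.val = 0
  · simp only [h0, if_true]
    by_cases h : q = p
    · subst h; simp
    · simp [h]
  by_cases hm : k.val = m
  · simp only [hm, if_true]
    by_cases h : q = p
    · subst h; simp
    · simp [h]
  simp only [h0, hm, if_false]
  have c1 : ((q : ℕ) = m - k.val - 1 ∧ (p : ℕ) = m - k.val - 1) =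
    ((p : ℕ) = m - k.val - 1 ∧ (q : ℕ) = m - k.val - 1) := propext and_comm
  have c3 : ((q : ℕ) = m - k.val ∧ (p : ℕ) = m - k.val) =
    ((p : ℕ) = m - k.val ∧ (q : ℕ) = m - k.val) := propext and_comm
  have c2 : (((q : ℕ) = m - k.val - 1 ∧ (p : ℕ) = m - k.val) ∨
      ((q : ℕ) = m - k.val ∧ (p : ℕ) = m - k.val - 1)) =
      (((p : ℕ) = m - k.val - 1 ∧ (q : ℕ) = m - k.val) ∨
      ((p : ℕ) = m - k.val ∧ (q : ℕ) = m - k.val - 1)) := by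
    apply propext; tauto
  simp only [c1, c2, c3]

theorem pp_transpose (l : List (SIdx × Matrix (Fin n) (Fin n) ℂ)) :
    (pp m n l)ᵀ = pp m n (l.reverse.map fun p => (p.1, p.2ᵀ)) := by
  induction l with
  | nil => simp [pp]
  | cons a l ih =>
    rw [pp_cons, Matrix.transpose_mul, ih, List.reverse_cons, List.map_append, pp_append]
    simp [pp, elemMat_transpose]

theorem zip_reverse_map {t : List SIdx} {Xs : List (Matrix (Fin n) (Fin n) ℂ)}
    (h : t.length = Xs.length) :
    t.reverse.zip (Xs.map Matrix.transpose).reverse =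
      (t.zip Xs).reverse.map fun p => (p.1, p.2ᵀ) := by
  rw [List.zip_eq_zipWith, List.zip_eq_zipWith, ← List.reverse_zipWith (by simpa using h),
    List.map_reverse, List.zipWith_map_right, List.map_zipWith]

theorem prodAssign_transpose {t : List SIdx} {Xs : List (Matrix (Fin n) (Fin n) ℂ)}
    (h : t.length = Xs.length) :
    (prodAssign m n t Xs)ᵀ = prodAssign m n t.reverse (Xs.map Matrix.transpose).reverse := by
  rw [prodAssign_eq, prodAssign_eq, pp_transpose, zip_reverse_map h]

theorem fiedlerX_transpose (A : ℕ → Matrix (Fin n) (Fin n) ℂ) (k : SIdx) :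
    (fiedlerX m A k)ᵀ = fiedlerX m (fun i => (A i)ᵀ) k := by
  cases k with
  | pos i => simp only [fiedlerX]; split_ifs <;> simp [Matrix.transpose_nonsing_inv]
  | neg i => simp only [fiedlerX]; split_ifs <;> simp [Matrix.transpose_nonsing_inv]

theorem prodFiedler_transpose (A : ℕ → Matrix (Fin n) (Fin n) ℂ) (t : List SIdx) :
    (prodFiedler m n A t)ᵀ = prodFiedler m n (fun i => (A i)ᵀ) t.reverse := by
  rw [prodFiedler_eq, prodFiedler_eq, pp_transpose]
  simp [fl, Function.comp_def, fiedlerX_transpose]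

theorem NonsingAssign_transpose {t : List SIdx} {Xs : List (Matrix (Fin n) (Fin n) ℂ)}
    (h : NonsingAssign m t Xs) :
    NonsingAssign m t.reverse (Xs.map Matrix.transpose).reverse := by
  refine ⟨by simpa using h.1, ?_⟩
  rw [zip_reverse_map h.1]
  intro p hp hv
  rw [List.mem_map] at hp
  obtain ⟨q, hq, rfl⟩ := hp
  exact Matrix.isUnit_transpose _ |>.2 (h.2 q (List.mem_reverse.1 hq) hv)

/-- The transposed data. -/
def trE (E : EGFPData m n) : EGFPData m n where
  A := fun i => (E.A i)ᵀ
  sig := E.sig.reverse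
  tau := E.tau.reverse
  sig1 := E.sig2.reverse
  sig2 := E.sig1.reverse
  tau1 := E.tau2.reverse
  tau2 := E.tau1.reverse
  X1 := (E.X2.map Matrix.transpose).reverse
  X2 := (E.X1.map Matrix.transpose).reverse
  Y1 := (E.Y2.map Matrix.transpose).reverse
  Y2 := (E.Y1.map Matrix.transpose).reverse
  hm := E.hm
  hAm := fun h => E.hAm (by simpa using h)
  hsigpos := fun k hk => E.hsigpos k (List.mem_reverse.1 hk)
  htauneg := fun k hk => E.htauneg k (List.mem_reverse.1 hk)
  hperm := by
    rw [List.map_reverse, List.map_reverse]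
    exact ((List.reverse_perm _).append (List.reverse_perm _)).trans E.hperm
  hsig1 := fun k hk => by simpa using E.hsig2 k (List.mem_reverse.1 hk)
  hsig2 := fun k hk => by simpa using E.hsig1 k (List.mem_reverse.1 hk)
  htau1 := fun k hk => by simpa using E.htau2 k (List.mem_reverse.1 hk)
  htau2 := fun k hk => by simpa using E.htau1 k (List.mem_reverse.1 hk)
  hSIPsig := by simpa [List.reverse_append, List.append_assoc] using SIP_reverse E.hSIPsig
  hSIPtau := by simpa [List.reverse_append, List.append_assoc] using SIP_reverse E.hSIPtau
  hX1 := NonsingAssign_transpose E.hX2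
  hX2 := NonsingAssign_transpose E.hX1
  hY1 := NonsingAssign_transpose E.hY2
  hY2 := NonsingAssign_transpose E.hY1
  hA0 := fun h => (Matrix.isUnit_transpose _).2 (E.hA0 (List.mem_reverse.1 h))
  hAmUnit := fun h => (Matrix.isUnit_transpose _).2 (E.hAmUnit (List.mem_reverse.1 h))

theorem trE_left (E : EGFPData m n) : (trE E).leftFac = E.rightFacᵀ := by
  rw [EGFPData.leftFac, EGFPData.rightFac, Matrix.transpose_mul,
    prodAssign_transpose E.hX2.1, prodAssign_transpose E.hY2.1]
  rfl

theorem trE_right (E : EGFPData m n) : (trE E).rightFac = E.leftFacᵀ := by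
  rw [EGFPData.leftFac, EGFPData.rightFac, Matrix.transpose_mul,
    prodAssign_transpose E.hX1.1, prodAssign_transpose E.hY1.1]
  rfl

theorem trE_L1 (E : EGFPData m n) : (trE E).L1 = E.L1ᵀ := by
  rw [EGFPData.L1, EGFPData.L1, trE_left, trE_right, Matrix.transpose_mul, Matrix.transpose_mul,
    prodFiedler_transpose, mul_assoc]
  rfl

theorem trE_L0 (E : EGFPData m n) : (trE E).L0 = E.L0ᵀ := by
  rw [EGFPData.L0, EGFPData.L0, trE_left, trE_right, Matrix.transpose_mul, Matrix.transpose_mul,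
    prodFiedler_transpose, mul_assoc]
  rfl

theorem isLeftPolyBasis_iff {α β : Type*} [Fintype α] {M : Matrix α β (RatFunc ℂ)}
    {p : ℕ} {v : Fin p → α → Polynomial ℂ} : IsLeftPolyBasis M v ↔ IsRightPolyBasis Mᵀ v := by
  simp only [IsLeftPolyBasis, IsRightPolyBasis, Matrix.mulVec_transpose]

theorem isLeftMinimalBasis_iff {α β : Type*} [Fintype α] {M : Matrix α β (RatFunc ℂ)}
    {p : ℕ} {v : Fin p → α → Polynomial ℂ} :
    IsLeftMinimalBasis M v ↔ IsRightMinimalBasis Mᵀ v := by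
  simp only [IsLeftMinimalBasis, IsRightMinimalBasis, isLeftPolyBasis_iff]

theorem isLeftMinBasisMat_iff {α β : Type*} [Fintype α] {M : Matrix α β (RatFunc ℂ)}
    {p : ℕ} {Z : Matrix α (Fin p) (Polynomial ℂ)} :
    IsLeftMinBasisMat M Z ↔ IsRightMinBasisMat Mᵀ Z := by
  simp only [IsLeftMinBasisMat, IsRightMinBasisMat, isLeftMinimalBasis_iff]

theorem leftMinIndices_iff {α β : Type*} [Fintype α] {M : Matrix α β (RatFunc ℂ)}
    {p : ℕ} {ε : Fin p → ℤ} : LeftMinIndices M ε ↔ RightMinIndices Mᵀ ε := by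
  simp only [LeftMinIndices, RightMinIndices, isLeftMinimalBasis_iff]

theorem reverse_sublist_iff' (l l' : List SIdx) : l.reverse.Sublist l' ↔ l.Sublist l'.reverse := by
  rw [← List.reverse_sublist, List.reverse_reverse]

theorem invsAt_eq (α : List SIdx) (t : SIdx) : invsAt α t = consAt α.reverse t := by
  simp only [invsAt, consAt, reverse_sublist_iff', List.mem_reverse, List.length_reverse]
  congr!

theorem totalCons_eq (m : ℕ) (α : List SIdx) : totalCons m α = totalInvs m α.reverse := by
  simp only [totalCons, totalInvs]
  congr 1
  ext i
  simp only [Finset.mem_filter]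
  rw [← reverse_sublist_iff']
  simp

theorem left_transfer (E : EGFPData m n) {τl τr : List SIdx} (hsing : (polyP m n E.A).det = 0)
    (hτ : E.tau = τl ++ SIdx.neg m :: τr) :
    Transfer (pencilPoly E.L1 E.L0)ᵀ (polyP m n E.A)ᵀ
      ((rowSel m n ((m : ℤ) - invsAt (E.sig1 ++ E.sig) (.pos 0))).map Polynomial.C)
      (totalCons m ((τl.reverse.map SIdx.negate) ++ E.sig ++ (τr.reverse.map SIdx.negate))) := by
  have hP : polyP m n (trE E).A = (polyP m n E.A)ᵀ := rfl
  have hL : pencilPoly (trE E).L1 (trE E).L0 = (pencilPoly E.L1 E.L0)ᵀ := by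
    rw [trE_L1, trE_L0]; rfl
  have h := main_transfer (trE E) (τl := τr.reverse) (τr := τl.reverse)
    (by rw [hP, Matrix.det_transpose, hsing])
    (by show E.tau.reverse = _; rw [hτ]; simp)
  rw [hP, hL] at h
  have e1 : consAt ((trE E).sig ++ (trE E).sig2) (.pos 0) = invsAt (E.sig1 ++ E.sig) (.pos 0) := by
    rw [invsAt_eq, List.reverse_append]; rfl
  have e2 : (τr.reverse.reverse.map SIdx.negate) ++ (trE E).sig ++
      (τl.reverse.reverse.map SIdx.negate) =
      ((τl.reverse.map SIdx.negate) ++ E.sig ++ (τr.reverse.map SIdx.negate)).reverse := by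
    show _ ++ E.sig.reverse ++ _ = _
    simp
  rw [e1, e2, ← totalCons_eq] at h
  exact h

end EGFPProof

/-- Let `L(λ)` be an EGFP of the singular matrix polynomial `P(λ)`,
write `τ = (τ_l, −m, τ_r)` and set `α := (−rev(τ_l), σ, −rev(τ_r))`, a permutation of
`{0,…,m−1}` with total numbers of consecutions `c_L` and inversions `i_L`.
(a) Right (resp. left) minimal bases of `L(λ)` yield right (resp. left) minimal bases
of `P(λ)` by multiplication with `e^T_{m−c₀(σ,σ₂)} ⊗ I_n` (resp.
`e^T_{m−i₀(σ₁,σ)} ⊗ I_n`).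
(b) The right (resp. left) minimal indices of `P(λ)` are those of `L(λ)` shifted down by
`i_L` (resp. `c_L`). -/
theorem egfp_minimal_bases_indices {m n : ℕ} (E : EGFPData m n)
    (hsing : (polyP m n E.A).det = 0)
    (τl τr : List SIdx) (hτ : E.tau = τl ++ SIdx.neg m :: τr) :
    -- (a) recovery of right and left minimal bases
    (∀ (p : ℕ) (Z : Matrix (Fin m × Fin n) (Fin p) (Polynomial ℂ)),
      IsRightMinBasisMat ((pencilPoly E.L1 E.L0).map toRF) Z →
      IsRightMinBasisMat ((polyP m n E.A).map toRF)
        ((rowSel m n ((m : ℤ) - consAt (E.sig ++ E.sig2) (.pos 0))).map Polynomial.C * Z)) ∧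
    (∀ (p : ℕ) (Z : Matrix (Fin m × Fin n) (Fin p) (Polynomial ℂ)),
      IsLeftMinBasisMat ((pencilPoly E.L1 E.L0).map toRF) Z →
      IsLeftMinBasisMat ((polyP m n E.A).map toRF)
        ((rowSel m n ((m : ℤ) - invsAt (E.sig1 ++ E.sig) (.pos 0))).map Polynomial.C * Z)) ∧
    -- (b) recovery of right and left minimal indices
    (∀ (p : ℕ) (ε : Fin p → ℤ),
      RightMinIndices ((pencilPoly E.L1 E.L0).map toRF) ε →
      RightMinIndices ((polyP m n E.A).map toRF)
        (fun j => ε j -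
          (totalInvs m ((τl.reverse.map SIdx.negate) ++ E.sig ++ (τr.reverse.map SIdx.negate)) : ℤ))) ∧
    (∀ (p : ℕ) (ε : Fin p → ℤ),
      LeftMinIndices ((pencilPoly E.L1 E.L0).map toRF) ε →
      LeftMinIndices ((polyP m n E.A).map toRF)
        (fun j => ε j -
          (totalCons m ((τl.reverse.map SIdx.negate) ++ E.sig ++ (τr.reverse.map SIdx.negate)) : ℤ))) := by
  exact ⟨fun p Z hZ => (EGFPProof.main_transfer E hsing hτ).minBasisMat hZ,
    fun p Z hZ => EGFPProof.isLeftMinBasisMat_iff.2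
      ((EGFPProof.left_transfer E hsing hτ).minBasisMat (EGFPProof.isLeftMinBasisMat_iff.1 hZ)),
    fun p ε h => (EGFPProof.main_transfer E hsing hτ).minIndices h,
    fun p ε h => EGFPProof.leftMinIndices_iff.2
      ((EGFPProof.left_transfer E hsing hτ).minIndices (EGFPProof.leftMinIndices_iff.1 h))⟩
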